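/- Let k, n ≥ 1 be natural numbers. If C is a metric continuum with dim C = k(n+1) − 1 (Lebesgue covering dimension), then X_C = Z(C,C) is a compact Fréchet space such that: (a) ∂Δ^k-dim X_C = n; (b) ∂Δ^k-Ind X_C = |∂Δ^k|-Ind X_C = n + 1; (c) ∂Δ^k-str X_C = 0 whenever k ≥ 2; and (d) every connected component of X_C is homeomorphic to C. -/

import Mathlib

open Set Topology Cardinal

noncomputable section

attribute [local instance] Classical.propDecidable

/-- Values of dimension functions: `⊥ : WithBot Ordinal.{0}` encodes `−1`,
ordinals are the usual values, and `⊤` encodes `∞`. -/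
abbrev Dim : Type 1 := WithTop (WithBot Ordinal.{0})

/-- An ordinal viewed as a dimension value. -/
def Dim.ofOrdinal (a : Ordinal.{0}) : Dim := ((a : WithBot Ordinal.{0}) : Dim)

/-- The dimension value `−1`. -/
def Dim.minusOne : Dim := ((⊥ : WithBot Ordinal.{0}) : Dim)

/-- An integer `m ≥ −1` viewed as a dimension value. -/
def Dim.ofInt (m : ℤ) : Dim := if 0 ≤ m then Dim.ofOrdinal m.toNat else Dim.minusOne

/-- `A` is a `K`-tuple for the simplicial complex `K` on the vertex set `Fin m`:
whenever the members indexed by a nonempty `I` have a common point, `I` spans a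
simplex of `K`. -/
def IsKTuple {m : ℕ} (K : Finset (Fin m) → Prop) {X : Type} (A : Fin m → Set X) : Prop :=
  ∀ I : Finset (Fin m), I.Nonempty → (⋂ i ∈ I, A i).Nonempty → K I

/-- `K` is an abstract (finite) simplicial complex with vertex set `Fin m`:
it is closed under passing to nonempty subsets, and contains every vertex. -/
def IsComplex {m : ℕ} (K : Finset (Fin m) → Prop) : Prop :=
  (∀ s t : Finset (Fin m), s ⊆ t → s.Nonempty → K t → K s) ∧ ∀ i, K {i}

/-- The boundary complex `∂Δ^k` of the `k`-simplex: all proper subsets of the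
`k+1` vertices span simplices. -/
def bComplex (k : ℕ) : Finset (Fin (k + 1)) → Prop := fun s => s ≠ Finset.univ

/-- `U` is an (open) `K`-neighbourhood of the tuple `F`. -/
def KNbhd {m : ℕ} (K : Finset (Fin m) → Prop) {X : Type} [TopologicalSpace X]
    (F U : Fin m → Set X) : Prop :=
  (∀ i, IsOpen (U i)) ∧ IsKTuple K U ∧ ∀ i, F i ⊆ U i

/-- Auxiliary form of `K-Ind X ≤ α`, defined by transfinite recursion on `α`:
every closed `K`-tuple has a `K`-neighbourhood whose corresponding `K`-partition
is either empty (dimension `−1`) or has `K-Ind < α`. -/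
def KIndLeAux {m : ℕ} (K : Finset (Fin m) → Prop) :
    Ordinal.{0} → ∀ X : Type, TopologicalSpace X → Prop :=
  (wellFounded_lt (α := Ordinal.{0})).fix fun α rec X tX =>
    letI := tX
    ∀ F : Fin m → Set X, (∀ i, IsClosed (F i)) → IsKTuple K F →
      ∃ U : Fin m → Set X, (∀ i, IsOpen (U i)) ∧ IsKTuple K U ∧ (∀ i, F i ⊆ U i) ∧
        ((⋃ i, U i)ᶜ = (∅ : Set X) ∨
          ∃ β : Set.Iio α, rec β.1 β.2 (↥((⋃ i, U i)ᶜ)) inferInstance)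

/-- `K-Ind X ≤ α` (for an ordinal `α ≥ 0`). -/
def KIndLE {m : ℕ} (K : Finset (Fin m) → Prop) (X : Type) [tX : TopologicalSpace X]
    (α : Ordinal.{0}) : Prop :=
  KIndLeAux K α X tX

/-- Fedorchuk's inductive dimension `K-Ind` modulo a simplicial complex `K`;
`−1` for the empty space, the least `α` with `K-Ind X ≤ α` otherwise, `∞` if none. -/
def KInd {m : ℕ} (K : Finset (Fin m) → Prop) (X : Type) [TopologicalSpace X] : Dim :=
  if IsEmpty X then Dim.minusOne
  else if ∃ α, KIndLE K X α then Dim.ofOrdinal (sInf {α | KIndLE K X α}) else ⊤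

/-- The set of `K`-obstruction points of an open `K`-tuple `U`: points covered
by no `K`-neighbourhood of `U`. -/
def KObs {m : ℕ} (K : Finset (Fin m) → Prop) {X : Type} [TopologicalSpace X]
    (U : Fin m → Set X) : Set X :=
  {x | ¬ ∃ V : Fin m → Set X, KNbhd K U V ∧ x ∈ ⋃ i, V i}

/-- `X` is strongly `α`-dimensional: `K-Ind X` is a positive ordinal `α` and some
closed `K`-tuple admits no `K`-neighbourhood `U` without obstruction points whose
corresponding `K`-partition has `K-Ind < α`. -/
def KStrongly {m : ℕ} (K : Finset (Fin m) → Prop) (X : Type) [TopologicalSpace X] : Prop :=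
  (∃ α : Ordinal.{0}, 0 < α ∧ KInd K X = Dim.ofOrdinal α) ∧
  ∃ F : Fin m → Set X, (∀ i, IsClosed (F i)) ∧ IsKTuple K F ∧
    ∀ U : Fin m → Set X, KNbhd K F U →
      KInd K (↥((⋃ i, U i)ᶜ)) < KInd K X → KObs K U ≠ ∅

/-- The dimensional strength degree `K-str X ∈ {0,1}`. -/
def KStr {m : ℕ} (K : Finset (Fin m) → Prop) (X : Type) [TopologicalSpace X] : ℕ :=
  if KStrongly K X then 1 else 0

/-- `K-dim X ≤ n`: any `n+1` closed `K`-tuples admit `K`-partitions with empty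
intersection. -/
def KDimLE {m : ℕ} (K : Finset (Fin m) → Prop) (X : Type) [TopologicalSpace X] (n : ℕ) : Prop :=
  ∀ F : Fin (n + 1) → Fin m → Set X,
    (∀ j i, IsClosed (F j i)) → (∀ j, IsKTuple K (F j)) →
    ∃ U : Fin (n + 1) → Fin m → Set X, (∀ j, KNbhd K (F j) (U j)) ∧
      (⋂ j, (⋃ i, U j i)ᶜ) = (∅ : Set X)

/-- Fedorchuk's dimension `K-dim` modulo a simplicial complex `K`. -/
def KDim {m : ℕ} (K : Finset (Fin m) → Prop) (X : Type) [TopologicalSpace X] : Dim :=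
  if IsEmpty X then Dim.minusOne
  else if ∃ n, KDimLE K X n then Dim.ofOrdinal ((sInf {n | KDimLE K X n} : ℕ) : Ordinal.{0}) else ⊤

/-- `dim X ≤ n` for the Lebesgue covering dimension: every finite open cover has
an open shrinking of order at most `n+1`. -/
def CovDimLE (X : Type) [TopologicalSpace X] (n : ℕ) : Prop :=
  ∀ (ι : Type), Finite ι → ∀ U : ι → Set X, (∀ i, IsOpen (U i)) → (⋃ i, U i) = Set.univ →
    ∃ V : ι → Set X, (∀ i, IsOpen (V i)) ∧ (∀ i, V i ⊆ U i) ∧ (⋃ i, V i) = Set.univ ∧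
      ∀ x : X, ({i | x ∈ V i}).ncard ≤ n + 1

/-- The Lebesgue covering dimension. -/
def covDim (X : Type) [TopologicalSpace X] : Dim :=
  if IsEmpty X then Dim.minusOne
  else if ∃ n, CovDimLE X n then Dim.ofOrdinal ((sInf {n | CovDimLE X n} : ℕ) : Ordinal.{0}) else ⊤

/-- `Ind X ≤ n` for the large inductive dimension, by recursion on `n`. -/
def IndLE : ℕ → ∀ X : Type, TopologicalSpace X → Prop
  | 0, X, tX =>
    letI := tX
    ∀ F U : Set X, IsClosed F → IsOpen U → F ⊆ U →
      ∃ V : Set X, IsOpen V ∧ F ⊆ V ∧ V ⊆ U ∧ frontier V = ∅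
  | n + 1, X, tX =>
    letI := tX
    ∀ F U : Set X, IsClosed F → IsOpen U → F ⊆ U →
      ∃ V : Set X, IsOpen V ∧ F ⊆ V ∧ V ⊆ U ∧ IndLE n (↥(frontier V)) inferInstance

/-- The large inductive dimension `Ind`. -/
def IndDim (X : Type) [tX : TopologicalSpace X] : Dim :=
  if IsEmpty X then Dim.minusOne
  else if ∃ n, IndLE n X tX then Dim.ofOrdinal ((sInf {n | IndLE n X tX} : ℕ) : Ordinal.{0}) else ⊤

/-- The relation generating the topological join `A ∗ B`: the copy of `B` is
collapsed at parameter `0`, the copy of `A` at parameter `1`. -/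
def JoinRel (A B : Type) : (A × B × unitInterval) → (A × B × unitInterval) → Prop :=
  fun p q => (p.2.2 = 0 ∧ q.2.2 = 0 ∧ p.1 = q.1) ∨ (p.2.2 = 1 ∧ q.2.2 = 1 ∧ p.2.1 = q.2.1)

/-- The topological join `A ∗ B`. -/
abbrev Join (A B : Type) [TopologicalSpace A] [TopologicalSpace B] : Type :=
  Quot (JoinRel A B)

/-- Auxiliary construction of the join of `n+1` copies of `L`, bundled with its
topology. -/
def JoinPowAux (L : Type) (tL : TopologicalSpace L) : ℕ → (T : Type) × TopologicalSpace T
  | 0 => ⟨L, tL⟩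
  | n + 1 =>
    let p := JoinPowAux L tL n
    letI := tL
    letI := p.2
    ⟨Join L p.1, inferInstance⟩

/-- The join `L ∗ ⋯ ∗ L` of `n+1` copies of `L`. -/
def JoinPow (L : Type) [tL : TopologicalSpace L] (n : ℕ) : Type :=
  (JoinPowAux L tL n).1

instance joinPowTopologicalSpace (L : Type) [tL : TopologicalSpace L] (n : ℕ) :
    TopologicalSpace (JoinPow L n) :=
  (JoinPowAux L tL n).2

/-- `L-dim X ≤ n`: every continuous map from a closed subset of `X` to the join
of `n+1` copies of `L` extends continuously over `X`. -/
def LDimLE (L : Type) [TopologicalSpace L] (X : Type) [TopologicalSpace X] (n : ℕ) : Prop :=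
  ∀ F : Set X, IsClosed F → ∀ f : C(F, JoinPow L n),
    ∃ g : C(X, JoinPow L n), ∀ x : F, g x = f x

/-- Fedorchuk's dimension `L-dim` modulo an ANR `L`. -/
def LDim (L : Type) [TopologicalSpace L] (X : Type) [TopologicalSpace X] : Dim :=
  if IsEmpty X then Dim.minusOne
  else if ∃ n, LDimLE L X n then Dim.ofOrdinal ((sInf {n | LDimLE L X n} : ℕ) : Ordinal.{0}) else ⊤

/-- Auxiliary form of `L-Ind X ≤ α`, by transfinite recursion on `α`: every map
to `L` from a closed subset of `X` has an `L`-partition which is either empty or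
has `L-Ind < α`. -/
def LIndLeAux (L : Type) [TopologicalSpace L] :
    Ordinal.{0} → ∀ X : Type, TopologicalSpace X → Prop :=
  (wellFounded_lt (α := Ordinal.{0})).fix fun α rec X tX =>
    letI := tX
    ∀ F : Set X, IsClosed F → ∀ f : C(F, L),
      ∃ U : Set X, IsOpen U ∧ ∃ hFU : F ⊆ U,
        (∃ g : C(U, L), ∀ (x : X) (hx : x ∈ F), g ⟨x, hFU hx⟩ = f ⟨x, hx⟩) ∧
        (Uᶜ = (∅ : Set X) ∨ ∃ β : Set.Iio α, rec β.1 β.2 (↥(Uᶜ)) inferInstance)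

/-- `L-Ind X ≤ α` (for an ordinal `α ≥ 0`). -/
def LIndLE (L : Type) [TopologicalSpace L] (X : Type) [tX : TopologicalSpace X]
    (α : Ordinal.{0}) : Prop :=
  LIndLeAux L α X tX

/-- Fedorchuk's inductive dimension `L-Ind` modulo an ANR `L`. -/
def LInd (L : Type) [TopologicalSpace L] (X : Type) [TopologicalSpace X] : Dim :=
  if IsEmpty X then Dim.minusOne
  else if ∃ α, LIndLE L X α then Dim.ofOrdinal (sInf {α | LIndLE L X α}) else ⊤

/-- `L` is an absolute neighbourhood retract (for metric spaces): `L` is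
metrizable and whenever a closed subset `A` of a metric space is homeomorphic to
`L` via `e`, the map `e` extends continuously over a neighbourhood of `A`. -/
def IsANR (L : Type) [TopologicalSpace L] : Prop :=
  TopologicalSpace.MetrizableSpace L ∧
  ∀ (M : Type) [MetricSpace M], ∀ A : Set M, IsClosed A → ∀ e : A ≃ₜ L,
    ∃ U : Set M, IsOpen U ∧ ∃ hAU : A ⊆ U, ∃ r : C(U, L),
      ∀ (a : M) (ha : a ∈ A), r ⟨a, hAU ha⟩ = e ⟨a, ha⟩

/-- `L-Ind_{b+} X`: the least dimension value `d` such that some open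
neighbourhood of `b` has closure of `L-Ind` at most `d`. -/
def LIndPlus (L : Type) [TopologicalSpace L] {X : Type} [TopologicalSpace X] (b : X) : Dim :=
  sInf {d : Dim | ∃ U : Set X, IsOpen U ∧ b ∈ U ∧ LInd L (↥(closure U)) ≤ d}

/-- The set `K(X) = {b ∈ X : L-Ind_{b+} X = L-Ind X}`. -/
def LKset (L : Type) [TopologicalSpace L] (X : Type) [TopologicalSpace X] : Set X :=
  {b | LIndPlus L b = LInd L X}

/-- The weight of a topological space: the least cardinality of a basis. -/
def tWeight (X : Type) [TopologicalSpace X] : Cardinal :=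
  sInf {c | ∃ B : Set (Set X), TopologicalSpace.IsTopologicalBasis B ∧ #B = c}

/-- The family `𝒮_X` of all subsets of `X` that are finite or homeomorphic to the
one-point compactification `A_{ℵ₀}` of a countably infinite discrete space. -/
def SFam (X : Type) [TopologicalSpace X] : Set (Set X) :=
  {S | S.Finite ∨ Nonempty (↥S ≃ₜ OnePoint ℕ)}

/-- The relation generating the quotient `N` in the `Z(X,Y)` construction:
each set `{μ} × {x} × Y` is collapsed to a point. -/
def ZRel (ι X Y : Type) : (OnePoint ι × X × Y) → (OnePoint ι × X × Y) → Prop :=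
  fun p q => p.1 = OnePoint.infty ∧ q.1 = OnePoint.infty ∧ p.2.1 = q.2.1

/-- The quotient space `N` of `A_𝔪 × X × Y`. -/
abbrev ZQuot (ι X Y : Type) [TopologicalSpace ι] [TopologicalSpace X] [TopologicalSpace Y] :
    Type :=
  Quot (ZRel ι X Y)

/-- The subset `Z(X,Y) = ⋃_{α ∈ A_𝔪} H(α)` of `N`:  `H(μ) = π₁({μ} × X × Y)` and
`H(α) = π₁({α} × φ(α) × Y)` for `α ≠ μ`. -/
def ZSet (ι X Y : Type) [TopologicalSpace ι] [TopologicalSpace X] [TopologicalSpace Y]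
    (φ : ι → Set X) : Set (ZQuot ι X Y) :=
  {z | ∃ p : OnePoint ι × X × Y, Quot.mk (ZRel ι X Y) p = z ∧
        (p.1 = OnePoint.infty ∨ ∃ i : ι, p.1 = (i : OnePoint ι) ∧ p.2.1 ∈ φ i)}

/-- The space `Z(X,Y)` (for the data `ι`, `φ`), with the subspace topology. -/
abbrev ZSpace (ι X Y : Type) [TopologicalSpace ι] [TopologicalSpace X] [TopologicalSpace Y]
    (φ : ι → Set X) : Type :=
  ↥(ZSet ι X Y φ)

/-- The subset `H(μ)` of `Z(X,Y)`. -/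
def ZHmu (ι X Y : Type) [TopologicalSpace ι] [TopologicalSpace X] [TopologicalSpace Y]
    (φ : ι → Set X) : Set (ZSpace ι X Y φ) :=
  {z | ∃ (x : X) (y : Y), (z : ZQuot ι X Y) = Quot.mk (ZRel ι X Y) (OnePoint.infty, x, y)}

/-- The projection `π_X : N → X`, `π₁(α,x,y) ↦ x`. -/
def ZQuotProjX {ι X Y : Type} [TopologicalSpace ι] [TopologicalSpace X] [TopologicalSpace Y] :
    ZQuot ι X Y → X :=
  Quot.lift (fun p => p.2.1) (fun _ _ h => h.2.2)

/-- The projection `π_X : Z(X,Y) → X`. -/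
def ZProjX {ι X Y : Type} [TopologicalSpace ι] [TopologicalSpace X] [TopologicalSpace Y]
    (φ : ι → Set X) : ZSpace ι X Y φ → X :=
  fun z => ZQuotProjX (z : ZQuot ι X Y)

/-- The cardinality requirements on the index set `ι` (of cardinality `𝔪`) in the
`Z(X,Y)` construction: `𝔪 ≥ max {ℵ₀, (wX)⁺, (wY)⁺, card 𝒮_X}`. -/
def ZCardOK (X Y ι : Type) [TopologicalSpace X] [TopologicalSpace Y] : Prop :=
  ℵ₀ ≤ #ι ∧ tWeight X < #ι ∧ tWeight Y < #ι ∧ #(SFam X) ≤ #ι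

/-- The requirements on `φ : A_𝔪 \ {μ} → 𝒮_X`: it takes values in `𝒮_X` and every
fibre has cardinality `𝔪`. -/
def ZPhiOK {X ι : Type} [TopologicalSpace X] (φ : ι → Set X) : Prop :=
  (∀ i, φ i ∈ SFam X) ∧ ∀ S ∈ SFam X, #(↥(φ ⁻¹' {S})) = #ι


/-- `0` is an unstable value on `S` for maps into `ℝ^J`. -/
def UnstOn {Y : Type} [TopologicalSpace Y] (S : Set Y) (J : Type) [Fintype J] : Prop :=
  ∀ (f : C(Y, J → ℝ)) (ε : ℝ), 0 < ε →
    ∃ g : C(Y, J → ℝ), (∀ x j, |g x j - f x j| < ε) ∧ ∀ x ∈ S, g x ≠ 0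

lemma UnstOn.mono {Y : Type} [TopologicalSpace Y] {S T : Set Y} {J : Type} [Fintype J]
    (h : UnstOn T J) (hST : S ⊆ T) : UnstOn S J := by
  intro f ε hε
  obtain ⟨g, h1, h2⟩ := h f ε hε
  exact ⟨g, h1, fun x hx => h2 x (hST hx)⟩

lemma UnstOn.of_card_le {Y : Type} [TopologicalSpace Y] {S : Set Y} {J J' : Type} [Fintype J]
    [Fintype J'] (h : UnstOn S J) (hc : Fintype.card J ≤ Fintype.card J') : UnstOn S J' := by
  obtain ⟨e⟩ := Function.Embedding.nonempty_of_card_le hc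
  intro f ε hε
  obtain ⟨g, h1, h2⟩ := h ⟨fun x j => f x (e j), by fun_prop⟩ ε hε
  refine ⟨⟨fun x j' => if hj : ∃ j, e j = j' then g x hj.choose else f x j', ?_⟩, ?_, ?_⟩
  · refine continuous_pi fun j' => ?_
    by_cases hj : ∃ j, e j = j'
    · simp only [hj, dite_true]
      fun_prop
    · simp only [hj, dite_false]
      fun_prop
  · intro x j'
    by_cases hj : ∃ j, e j = j'
    · simp only [ContinuousMap.coe_mk, hj, dite_true]
      have := h1 x hj.choose
      simp only [ContinuousMap.coe_mk, hj.choose_spec] at this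
      exact this
    · simp [hj, hε]
  · intro x hx h0
    apply h2 x hx
    funext j
    have hj : ∃ j0, e j0 = e j := ⟨j, rfl⟩
    have := congrFun h0 (e j)
    simp only [ContinuousMap.coe_mk, hj, dite_true] at this
    have e1 : hj.choose = j := e.injective hj.choose_spec
    rw [e1] at this
    exact this

/-- On a compact set a nowhere zero map is bounded away from zero. -/
lemma exists_pos_bound {Y : Type} [TopologicalSpace Y] {A : Set Y} (hA : IsCompact A)
    {J : Type} [Fintype J] (g : C(Y, J → ℝ)) (hg : ∀ x ∈ A, g x ≠ 0) :
    ∃ δ > 0, ∀ x ∈ A, ∃ j, δ ≤ |g x j| := by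
  rcases A.eq_empty_or_nonempty with rfl | hne
  · exact ⟨1, one_pos, by simp⟩
  obtain ⟨x0, hx0, hmin⟩ := hA.exists_isMinOn hne (f := fun x => ‖g x‖) (by fun_prop)
  refine ⟨‖g x0‖, norm_pos_iff.mpr (hg x0 hx0), fun x hx => ?_⟩
  by_contra hcon
  push Not at hcon
  have h1 : ‖g x‖ < ‖g x0‖ := by
    rw [pi_norm_lt_iff (norm_pos_iff.mpr (hg x0 hx0))]
    exact hcon
  exact absurd (hmin hx) (not_le.mpr h1)

lemma UnstOn.union {Y : Type} [TopologicalSpace Y] {A B : Set Y} {J : Type} [Fintype J]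
    (hcA : IsCompact A) (hA : UnstOn A J) (hB : UnstOn B J) : UnstOn (A ∪ B) J := by
  intro f ε hε
  obtain ⟨g, h1, h2⟩ := hA f (ε / 2) (by positivity)
  obtain ⟨δ, hδ, hδ2⟩ := exists_pos_bound hcA g h2
  obtain ⟨g', h1', h2'⟩ := hB g (min (ε / 2) δ) (by positivity)
  refine ⟨g', fun x j => ?_, fun x hx => ?_⟩
  · have a1 := h1 x j
    have a2 := lt_of_lt_of_le (h1' x j) (min_le_left _ _)
    calc |g' x j - f x j| = |(g' x j - g x j) + (g x j - f x j)| := by ring_nf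
      _ ≤ _ := abs_add_le _ _
      _ < ε := by linarith
  · rcases hx with hx | hx
    · obtain ⟨j, hj⟩ := hδ2 x hx
      intro h0
      have a2 := lt_of_lt_of_le (h1' x j) (min_le_right _ _)
      rw [h0] at a2
      simp only [Pi.zero_apply, zero_sub, abs_neg] at a2
      linarith
    · exact h2' x hx

lemma UnstOn.empty {Y : Type} [TopologicalSpace Y] {J : Type} [Fintype J] :
    UnstOn (∅ : Set Y) J := fun f ε hε => ⟨f, by simp [hε], by simp⟩

lemma UnstOn.biUnion {Y : Type} [TopologicalSpace Y] {J : Type} [Fintype J] {T : Type}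
    (s : Finset T) (A : T → Set Y) (hc : ∀ t ∈ s, IsCompact (A t))
    (h : ∀ t ∈ s, UnstOn (A t) J) : UnstOn (⋃ t ∈ s, A t) J := by
  induction s using Finset.induction_on with
  | empty => simpa using UnstOn.empty
  | insert a s ha ih =>
    rw [Finset.set_biUnion_insert]
    exact UnstOn.union (hc a (by simp)) (h a (by simp))
      (ih (fun t ht => hc t (by simp [ht])) (fun t ht => h t (by simp [ht])))

/-- Zero-dimensional target: unstable only on the empty set. -/
lemma UnstOn.eq_empty {Y : Type} [TopologicalSpace Y] {S : Set Y} {J : Type} [Fintype J]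
    [IsEmpty J] (h : UnstOn S J) : S = ∅ := by
  obtain ⟨g, -, h2⟩ := h 0 1 one_pos
  by_contra hne
  obtain ⟨x, hx⟩ := Set.nonempty_iff_ne_empty.mpr hne
  exact h2 x hx (Subsingleton.elim _ _)

/-- Extension of a small map from a closed subspace. -/
lemma extend_small {Y Y' : Type} [TopologicalSpace Y] [TopologicalSpace Y'] [NormalSpace Y']
    {e : Y → Y'} (he : IsClosedEmbedding e) {J : Type} (h : C(Y, J → ℝ))
    {t : Set ℝ} [OrdConnected t] (hne : t.Nonempty) (ht : ∀ x j, h x j ∈ t) :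
    ∃ h' : C(Y', J → ℝ), (∀ y j, h' y j ∈ t) ∧ ∀ x, h' (e x) = h x := by
  have := fun j => ContinuousMap.exists_extension_forall_mem_of_isClosedEmbedding
    (⟨fun x => h x j, by fun_prop⟩ : C(Y, ℝ)) (t := t) (fun x => ht x j) hne he
  choose g hg1 hg2 using this
  refine ⟨⟨fun y j => g j y, by fun_prop⟩, fun y j => hg1 j y, fun x => ?_⟩
  funext j
  exact congrFun (hg2 j) x

lemma UnstOn.image {Y Y' : Type} [TopologicalSpace Y] [TopologicalSpace Y'] [NormalSpace Y']
    {e : Y → Y'} (he : IsClosedEmbedding e) {J : Type} [Fintype J] {S : Set Y}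
    (h : UnstOn S J) : UnstOn (e '' S) J := by
  intro f ε hε
  obtain ⟨g, h1, h2⟩ := h (f.comp ⟨e, he.continuous⟩) ε hε
  obtain ⟨d, hd1, hd2⟩ := extend_small he (g - f.comp ⟨e, he.continuous⟩) (t := Ioo (-ε) ε)
    ⟨0, by simp [hε]⟩ (fun x j => by
      have := h1 x j
      rw [abs_lt] at this
      simpa using this)
  refine ⟨f + d, fun y j => ?_, ?_⟩
  · have := hd1 y j
    rw [mem_Ioo, ← abs_lt] at this
    simpa using this
  · rintro _ ⟨x, hx, rfl⟩
    have : (f + d) (e x) = g x := by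
      simp [hd2 x]
    rw [this]
    exact h2 x hx

lemma UnstOn.preimage {Y Y' : Type} [TopologicalSpace Y] [TopologicalSpace Y'] [NormalSpace Y']
    {e : Y → Y'} (he : IsClosedEmbedding e) {J : Type} [Fintype J] {S : Set Y'}
    (h : UnstOn S J) : UnstOn (e ⁻¹' S) J := by
  intro f ε hε
  obtain ⟨f', -, hf'⟩ := extend_small he f (t := univ) ⟨0, by simp⟩ (by simp)
  obtain ⟨g, h1, h2⟩ := h f' ε hε
  refine ⟨g.comp ⟨e, he.continuous⟩, fun x j => ?_, fun x hx => h2 _ hx⟩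
  have := h1 (e x) j
  rw [hf' x] at this
  exact this

/-- A closed subset of a normal space. -/
lemma UnstOn.subtype {Y : Type} [TopologicalSpace Y] [NormalSpace Y] {S : Set Y} (hS : IsClosed S)
    {J : Type} [Fintype J] (h : UnstOn S J) : UnstOn (univ : Set S) J :=
  (h.preimage hS.isClosedEmbedding_subtypeVal).mono (fun x _ => x.2)

lemma UnstOn.of_subtype {Y : Type} [TopologicalSpace Y] [NormalSpace Y] {S : Set Y}
    (hS : IsClosed S) {J : Type} [Fintype J] (h : UnstOn (univ : Set S) J) : UnstOn S J :=
  (h.image hS.isClosedEmbedding_subtypeVal).mono (by simp)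

lemma genpos_exact (N : ℕ) {T : Type} [Fintype T] (v : T → Fin N → ℝ) (ε : ℝ) (hε : 0 < ε) :
    ∃ w : T → Fin N → ℝ, (∀ t j, |w t j - v t j| < ε) ∧
      ∀ s : Fin N → T, Function.Injective s → (Matrix.of fun i j => w (s i) j).det ≠ 0 := by
  obtain ⟨c⟩ : Nonempty (T ≃ Fin (Fintype.card T)) := ⟨Fintype.equivFin T⟩
  let m : T → Fin N → ℝ := fun t j => ((c t : ℕ) : ℝ) ^ (j : ℕ)
  have hm : ∀ s : Fin N → T, Function.Injective s → (Matrix.of fun i j => m (s i) j).det ≠ 0 := by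
    intro s hs
    have : (Matrix.of fun i j => m (s i) j) =
        Matrix.vandermonde (fun i => ((c (s i) : ℕ) : ℝ)) := by
      ext i j; simp [m, Matrix.vandermonde]
    rw [this, Matrix.det_vandermonde_ne_zero_iff]
    intro a b hab
    simp only [Nat.cast_inj] at hab
    exact hs (c.injective (Fin.ext hab))
  let p : (Fin N → T) → Polynomial ℝ := fun s =>
    Matrix.det ((Polynomial.X : Polynomial ℝ) • (Matrix.of fun i j => m (s i) j).map Polynomial.C
      + (Matrix.of fun i j => v (s i) j).map Polynomial.C)
  have hp : ∀ s, Function.Injective s → p s ≠ 0 := by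
    intro s hs h0
    have := Polynomial.coeff_det_X_add_C_card (Matrix.of fun i j => m (s i) j)
      (Matrix.of fun i j => v (s i) j)
    change (p s).coeff _ = _ at this
    rw [h0] at this
    exact hm s hs (by simpa using this.symm)
  obtain ⟨B, hB⟩ : ∃ B : ℝ, ∀ t j, |m t j| ≤ B := by
    obtain ⟨B, hB⟩ := (Set.finite_range (fun q : T × Fin N => |m q.1 q.2|)).bddAbove
    exact ⟨B, fun t j => hB ⟨(t, j), rfl⟩⟩
  let bad : Set ℝ := ⋃ s ∈ {s : Fin N → T | Function.Injective s}, {x | (p s).IsRoot x}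
  have hbad : bad.Finite := by
    refine Set.Finite.biUnion (Set.toFinite _) fun s hs => ?_
    exact Polynomial.finite_setOfPred_isRoot (hp s hs)
  have hpos : 0 < ε / (|B| + 1) := by positivity
  obtain ⟨δ, hδ, hδb⟩ := ((Set.Ioo_infinite hpos).sdiff hbad).nonempty
  refine ⟨fun t j => δ * m t j + v t j, fun t j => ?_, fun s hs h0 => ?_⟩
  · rw [add_sub_cancel_right, abs_mul, abs_of_pos hδ.1]
    have h1 : |m t j| ≤ |B| := (hB t j).trans (le_abs_self B)
    have h2 : δ * (|B| + 1) < ε := (lt_div_iff₀ (by positivity)).mp hδ.2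
    have h3 : δ * |m t j| ≤ δ * |B| := mul_le_mul_of_nonneg_left h1 hδ.1.le
    nlinarith [hδ.1]
  · apply hδb
    simp only [bad, mem_iUnion]
    refine ⟨s, hs, ?_⟩
    change (p s).eval δ = 0
    rw [← h0]
    simp only [p]
    rw [← Polynomial.coe_evalRingHom, RingHom.map_det]
    congr 1
    ext i j
    simp [RingHom.mapMatrix_apply]
    exact mul_comm _ _

lemma genpos (N : ℕ) {T : Type} [Fintype T] (v : T → Fin N → ℝ) (ε : ℝ) (hε : 0 < ε) :
    ∃ w : T → Fin N → ℝ, (∀ t j, |w t j - v t j| < ε) ∧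
      ∀ S : Finset T, S.card ≤ N → ∀ c : T → ℝ, (∀ t, t ∉ S → c t = 0) →
        (∀ j, ∑ t, c t * w t j = 0) → ∀ t, c t = 0 := by
  obtain ⟨w, hw1, hw2⟩ := genpos_exact N (T := T ⊕ Fin N) (Sum.elim v (fun _ _ => 0)) ε hε
  refine ⟨fun t => w (Sum.inl t), fun t j => by simpa using hw1 (Sum.inl t) j, ?_⟩
  intro S hS c hc h0
  obtain ⟨S', hSS, -, hS'⟩ := Finset.exists_subsuperset_card_eq
    (s := S.map Function.Embedding.inl) (t := (Finset.univ : Finset (T ⊕ Fin N))) (n := N)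
    (Finset.subset_univ _) (by simpa using hS) (by simp)
  let e : Fin N ≃ S' := (Fintype.equivFinOfCardEq (by simpa using hS')).symm
  have hdet := hw2 (fun i => (e i : T ⊕ Fin N)) (Subtype.val_injective.comp e.injective)
  let c' : T ⊕ Fin N → ℝ := Sum.elim c (fun _ => 0)
  have hc' : ∀ u, u ∉ S' → c' u = 0 := by
    rintro (t | t) hu
    · apply hc
      intro ht
      exact hu (hSS (by simpa using ht))
    · rfl
  have hz : Matrix.vecMul (fun i => c' (e i)) (Matrix.of fun i j => w (e i : T ⊕ Fin N) j) = 0 := by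
    funext j
    simp only [Matrix.vecMul, dotProduct, Matrix.of_apply, Pi.zero_apply]
    rw [Equiv.sum_comp e (fun u : S' => c' u * w u j)]
    rw [Finset.sum_coe_sort S' (fun u => c' u * w u j)]
    rw [Finset.sum_subset (Finset.subset_univ S') (fun u _ hu => by simp [hc' u hu])]
    rw [Fintype.sum_sum_type]
    simpa [c'] using h0 j
  have hz' := Matrix.eq_zero_of_vecMul_eq_zero hdet hz
  intro t
  by_cases ht : t ∈ S
  · have hm : Sum.inl t ∈ S' := hSS (by simpa using ht)
    have := congrFun hz' (e.symm ⟨_, hm⟩)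
    simpa [c'] using this
  · exact hc t ht

/-- `dim X ≤ d` implies that `0` is unstable for maps to `ℝ^{d+1}`. -/
lemma unst_of_covDimLE {X : Type} [TopologicalSpace X] [NormalSpace X] [CompactSpace X] {d : ℕ}
    (h : CovDimLE X d) : UnstOn (univ : Set X) (Fin (d + 1)) := by
  intro f ε hε
  obtain ⟨t, ht⟩ := isCompact_univ.elim_finite_subcover
    (fun x : X => f ⁻¹' (Metric.ball (f x) (ε / 2)))
    (fun x => Metric.isOpen_ball.preimage f.continuous)
    (fun x _ => mem_iUnion.mpr ⟨x, by simpa using by positivity⟩)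
  obtain ⟨V, hV1, hV2, hV3, hV4⟩ := h (↥t) inferInstance
    (fun x => f ⁻¹' (Metric.ball (f x) (ε / 2)))
    (fun x => Metric.isOpen_ball.preimage f.continuous)
    (by
      refine eq_univ_of_univ_subset (ht.trans ?_)
      intro y hy
      simp only [mem_iUnion] at hy ⊢
      obtain ⟨x, hx, hy⟩ := hy
      exact ⟨⟨x, hx⟩, hy⟩)
  obtain ⟨ρ, hρ⟩ := PartitionOfUnity.exists_isSubordinate_of_locallyFinite isClosed_univ V hV1
    (locallyFinite_of_finite V) (by rw [hV3])
  obtain ⟨w, hw1, hw2⟩ := genpos (d + 1) (fun x : t => f x) (ε / 2) (by positivity)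
  have hsum : ∀ x, ∑ i, ρ i x = 1 := fun x => by
    rw [← finsum_eq_sum_of_fintype]
    exact ρ.sum_eq_one (mem_univ x)
  have hmem : ∀ i x, ρ i x ≠ 0 → x ∈ V i := fun i x hx =>
    hρ i (subset_tsupport _ hx)
  refine ⟨⟨fun x j => ∑ i, ρ i x * w i j, by fun_prop⟩, fun x j => ?_, fun x _ h0 => ?_⟩
  · have e1 : (∑ i, ρ i x * w i j) - f x j = ∑ i, ρ i x * (w i j - f x j) := by
      simp only [mul_sub, Finset.sum_sub_distrib, ← Finset.sum_mul, hsum, one_mul]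
    simp only [ContinuousMap.coe_mk]
    rw [e1]
    refine (Finset.abs_sum_le_sum_abs _ _).trans_lt ?_
    have hlt : ∀ i, ρ i x ≠ 0 → |w i j - f x j| < ε := by
      intro i hi
      have h1 := hV2 i (hmem i x hi)
      simp only [mem_preimage, Metric.mem_ball] at h1
      have h2 : |f x j - f i j| < ε / 2 := lt_of_le_of_lt (by
        have := dist_le_pi_dist (f x) (f i) j
        rwa [Real.dist_eq] at this) h1
      have h3 := hw1 i j
      rw [abs_lt] at *
      constructor <;> linarith [h2.1, h2.2, h3.1, h3.2]
    obtain ⟨i0, hi0⟩ : ∃ i, ρ i x ≠ 0 := by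
      by_contra hcon
      push Not at hcon
      have := hsum x
      simp [hcon] at this
    calc ∑ i, |ρ i x * (w i j - f x j)| < ∑ i, ρ i x * ε := by
          apply Finset.sum_lt_sum
          · intro i _
            rw [abs_mul, abs_of_nonneg (ρ.nonneg i x)]
            by_cases hi : ρ i x = 0
            · simp [hi]
            · exact mul_le_mul_of_nonneg_left (hlt i hi).le (ρ.nonneg i x)
          · refine ⟨i0, Finset.mem_univ _, ?_⟩
            rw [abs_mul, abs_of_nonneg (ρ.nonneg i0 x)]
            exact mul_lt_mul_of_pos_left (hlt i0 hi0)
              (lt_of_le_of_ne (ρ.nonneg i0 x) (Ne.symm hi0))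
      _ = ε := by rw [← Finset.sum_mul, hsum, one_mul]
  · have := hw2 (Finset.univ.filter fun i => x ∈ V i)
      (by
        have := hV4 x
        rwa [Set.ncard_eq_toFinset_card', Set.toFinset_ofPred] at this)
      (fun i => ρ i x) (fun i hi => by
        by_contra hne
        exact hi (by simpa using hmem i x hne))
      (fun j => congrFun h0 j)
    have h1 := hsum x
    simp [this] at h1

lemma shrink_one {X : Type} [TopologicalSpace X] [NormalSpace X] {d : ℕ}
    (h : UnstOn (univ : Set X) (Fin (d + 1))) {ι : Type} [Fintype ι] (V : ι → Set X)
    (hV : ∀ i, IsOpen (V i)) (hc : (⋃ i, V i) = Set.univ) (I : Finset ι) (hI : I.card = d + 2) :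
    ∃ V' : ι → Set X, (∀ i, IsOpen (V' i)) ∧ (∀ i, V' i ⊆ V i) ∧ (⋃ i, V' i) = Set.univ ∧
      ∀ x, ∃ i ∈ I, x ∉ V' i := by
  obtain ⟨A, hA1, hA2, hA3⟩ := exists_iUnion_eq_closed_subset hV (fun x => Set.toFinite _) hc
  have hf : ∀ i, ∃ f : C(X, ℝ), EqOn f 0 (V i)ᶜ ∧ EqOn f 1 (A i) ∧ ∀ x, f x ∈ Icc (0 : ℝ) 1 :=
    fun i => exists_continuous_zero_one_of_isClosed (hV i).isClosed_compl (hA2 i)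
      (disjoint_left.mpr fun x hx hx' => hx (hA3 i hx'))
  choose f hf0 hf1 hf2 using hf
  obtain ⟨i0, hi0⟩ : I.Nonempty := by rw [← Finset.card_pos]; omega
  have hcard : Fintype.card (Fin (d + 1)) ≤ Fintype.card (I.erase i0) := by
    rw [Fintype.card_coe, Finset.card_erase_of_mem hi0, hI]; simp
  obtain ⟨g, hg1, hg2⟩ := h.of_card_le hcard ⟨fun x i => f i x - f i0 x, by fun_prop⟩ (1 / 4)
    (by norm_num)
  let G : ι → C(X, ℝ) := fun i =>
    if hi : i ∈ I.erase i0 then ⟨fun x => g x ⟨i, hi⟩, by fun_prop⟩ else 0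
  have hG : ∀ i ∈ I, ∀ x, |G i x - (f i x - f i0 x)| < 1 / 4 := by
    intro i hi x
    by_cases hi' : i ∈ I.erase i0
    · have := hg1 x ⟨i, hi'⟩
      simp only [G, hi', dite_true]
      exact this
    · have e : i = i0 := by
        by_contra hne
        exact hi' (Finset.mem_erase.mpr ⟨hne, hi⟩)
      subst e
      simp [G]
  have hGne : ∀ x, ∃ i ∈ I, G i x ≠ 0 := by
    intro x
    by_contra hcon
    push Not at hcon
    apply hg2 x (mem_univ x)
    funext i
    have := hcon i (Finset.mem_of_mem_erase i.2)
    simp only [G, i.2, dite_true] at this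
    exact this
  have hG0 : ∀ x, G i0 x = 0 := fun x => by simp [G]
  refine ⟨fun i => if i ∈ I then V i ∩ ⋃ j ∈ I, {x | G j x < G i x} else V i, ?_, ?_, ?_, ?_⟩
  · intro i
    dsimp only
    split_ifs
    · refine (hV i).inter (isOpen_biUnion fun j _ => ?_)
      exact isOpen_lt (by fun_prop) (by fun_prop)
    · exact hV i
  · intro i
    dsimp only
    split_ifs
    · exact inter_subset_left
    · exact subset_rfl
  · refine eq_univ_of_forall fun x => ?_
    have hx : x ∈ ⋃ i, A i := by rw [hA1]; trivial
    obtain ⟨l, hl⟩ := mem_iUnion.mp hx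
    rw [mem_iUnion]
    by_cases hlI : l ∈ I
    · by_cases hlow : ∃ j ∈ I, G j x < G l x
      · refine ⟨l, ?_⟩
        simp only [hlI, if_true]
        refine ⟨hA3 l hl, ?_⟩
        simpa using hlow
      · push Not at hlow
        -- `G l x` is minimal
        have hex : ∃ j ∈ I, G l x < G j x := by
          by_contra hcon
          push Not at hcon
          have hall : ∀ j ∈ I, G j x = G l x := fun j hj => le_antisymm (hcon j hj) (hlow j hj)
          obtain ⟨i, hi, hne⟩ := hGne x
          exact hne (by rw [hall i hi, ← hall i0 hi0, hG0])
        obtain ⟨j, hj, hlt⟩ := hex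
        refine ⟨j, ?_⟩
        simp only [hj, if_true]
        refine ⟨?_, ?_⟩
        · by_contra hxV
          have h1 : f j x = 0 := hf0 j hxV
          have h2 : f l x = 1 := hf1 l hl
          have h3 := hG j hj x
          have h4 := hG l hlI x
          rw [abs_lt] at h3 h4
          linarith [h3.1, h3.2, h4.1, h4.2]
        · simp only [mem_iUnion]
          exact ⟨l, hlI, hlt⟩
    · refine ⟨l, ?_⟩
      simp only [hlI, if_false]
      exact hA3 l hl
  · intro x
    obtain ⟨i, hi, hmin⟩ := Finset.exists_min_image I (fun i => G i x) ⟨i0, hi0⟩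
    refine ⟨i, hi, ?_⟩
    simp only [hi, if_true]
    rintro ⟨-, hx⟩
    simp only [mem_iUnion] at hx
    obtain ⟨j, hj, hlt⟩ := hx
    exact absurd (hmin j hj) (not_le.mpr hlt)

lemma covDimLE_of_unst {X : Type} [TopologicalSpace X] [NormalSpace X] {d : ℕ}
    (h : UnstOn (univ : Set X) (Fin (d + 1))) : CovDimLE X d := by
  intro ι hfin U hU hc
  have : Fintype ι := Fintype.ofFinite ι
  have key : ∀ 𝓘 : Finset (Finset ι), (∀ I ∈ 𝓘, I.card = d + 2) →
      ∃ V : ι → Set X, (∀ i, IsOpen (V i)) ∧ (∀ i, V i ⊆ U i) ∧ (⋃ i, V i) = Set.univ ∧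
        ∀ I ∈ 𝓘, ∀ x, ∃ i ∈ I, x ∉ V i := by
    intro 𝓘
    induction 𝓘 using Finset.induction_on with
    | empty => exact fun _ => ⟨U, hU, fun _ => subset_rfl, hc, by simp⟩
    | insert I 𝓘 hI ih =>
      intro hcard
      obtain ⟨V, h1, h2, h3, h4⟩ := ih (fun J hJ => hcard J (by simp [hJ]))
      obtain ⟨V', h1', h2', h3', h4'⟩ := shrink_one h V h1 h3 I (hcard I (by simp))
      refine ⟨V', h1', fun i => (h2' i).trans (h2 i), h3', ?_⟩
      intro J hJ x
      rcases Finset.mem_insert.mp hJ with rfl | hJ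
      · exact h4' x
      · obtain ⟨i, hi, hx⟩ := h4 J hJ x
        exact ⟨i, hi, fun hx' => hx (h2' i hx')⟩
  obtain ⟨V, h1, h2, h3, h4⟩ := key (Finset.univ.filter fun I => I.card = d + 2) (by simp)
  refine ⟨V, h1, h2, h3, fun x => ?_⟩
  by_contra hcon
  push Not at hcon
  rw [Set.ncard_eq_toFinset_card'] at hcon
  obtain ⟨I, hI1, hI2⟩ := Finset.exists_subset_card_eq (n := d + 2) hcon
  obtain ⟨i, hi, hx⟩ := h4 I (by simp [hI2]) x
  exact hx (by simpa using hI1 hi)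

lemma isKTuple_iff {k : ℕ} {X : Type} {A : Fin (k + 1) → Set X} :
    IsKTuple (bComplex k) A ↔ ∀ x, ∃ i, x ∉ A i := by
  constructor
  · intro h x
    by_contra hcon
    push Not at hcon
    exact h Finset.univ Finset.univ_nonempty ⟨x, by simpa using hcon⟩ rfl
  · rintro h I - ⟨x, hx⟩ rfl
    obtain ⟨i, hi⟩ := h x
    simp only [mem_iInter] at hx
    exact hi (hx i (Finset.mem_univ i))

lemma exists_neg_of_sum_zero {m : ℕ} {h : Fin m → ℝ} (hs : ∑ i, h i = 0) (h0 : h ≠ 0) :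
    ∃ i, h i < 0 := by
  by_contra hcon
  push Not at hcon
  apply h0
  funext i
  exact (Finset.sum_eq_zero_iff_of_nonneg (fun i _ => hcon i)).mp hs i (Finset.mem_univ i)

lemma exists_nonneg_of_sum_zero {m : ℕ} {h : Fin (m + 1) → ℝ} (hs : ∑ i, h i = 0) :
    ∃ i, 0 ≤ h i := by
  by_contra hcon
  push Not at hcon
  have := Finset.sum_neg (fun i _ => hcon i) (Finset.univ_nonempty (α := Fin (m + 1)))
  linarith

/-- The linear isomorphism of `ℝ^k` with the hyperplane of vectors with zero sum. -/
def xt {k : ℕ} (v : Fin k → ℝ) : Fin (k + 1) → ℝ := Fin.cons (-∑ i, v i) v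

lemma xt_succ {k : ℕ} (v : Fin k → ℝ) (i : Fin k) : xt v i.succ = v i := by simp [xt]

lemma xt_zero {k : ℕ} (v : Fin k → ℝ) : xt v 0 = -∑ i, v i := by simp [xt]

lemma xt_sum {k : ℕ} (v : Fin k → ℝ) : ∑ i, xt v i = 0 := by
  rw [Fin.sum_univ_succ]; simp [xt]

lemma xt_tail {k : ℕ} (h : Fin (k + 1) → ℝ) (hs : ∑ i, h i = 0) :
    xt (fun i : Fin k => h i.succ) = h := by
  funext i
  refine Fin.cases ?_ (fun i => ?_) i
  · rw [xt_zero]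
    rw [Fin.sum_univ_succ] at hs
    linarith
  · rw [xt_succ]

lemma xt_ne_zero {k : ℕ} {v : Fin k → ℝ} (hv : v ≠ 0) : xt v ≠ 0 := by
  intro h
  apply hv
  funext i
  rw [← xt_succ v i, h]; rfl

@[fun_prop]
lemma continuous_xt {k : ℕ} : Continuous (xt : (Fin k → ℝ) → Fin (k + 1) → ℝ) := by
  refine continuous_pi fun i => ?_
  refine Fin.cases ?_ (fun i => ?_) i
  · simp only [xt_zero]; fun_prop
  · simp only [xt_succ]; fun_prop

/-- Barycentric coordinates (shifted) of a closed tuple. -/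
lemma bary {k : ℕ} {Y : Type} [TopologicalSpace Y] [NormalSpace Y] (F : Fin (k + 1) → Set Y)
    (hF : ∀ i, IsClosed (F i)) (hK : IsKTuple (bComplex k) F) :
    ∃ h : C(Y, Fin (k + 1) → ℝ), (∀ x, ∑ i, h x i = 0) ∧ ∀ i, ∀ x ∈ F i, h x i = -1 := by
  rw [isKTuple_iff] at hK
  obtain ⟨ρ, hρ⟩ := PartitionOfUnity.exists_isSubordinate_of_locallyFinite isClosed_univ
    (fun i => (F i)ᶜ) (fun i => (hF i).isOpen_compl) (locallyFinite_of_finite _)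
    (fun x _ => mem_iUnion.mpr (hK x))
  have hsum : ∀ x, ∑ i, ρ i x = 1 := fun x => by
    rw [← finsum_eq_sum_of_fintype]
    exact ρ.sum_eq_one (mem_univ x)
  refine ⟨⟨fun x i => (k + 1) * ρ i x - 1, by fun_prop⟩, fun x => ?_, fun i x hx => ?_⟩
  · simp only [ContinuousMap.coe_mk, Finset.sum_sub_distrib, ← Finset.mul_sum, hsum]
    simp
  · have : ρ i x = 0 := by
      by_contra hne
      exact hρ i (subset_tsupport _ hne) hx
    simp [this]

lemma tuple_of_fun {k : ℕ} {Y : Type} (h : Y → Fin (k + 1) → ℝ) (hs : ∀ x, ∑ i, h x i = 0)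
    (W : Set Y) : IsKTuple (bComplex k) (fun i => {x | x ∈ W ∧ h x i < 0}) := by
  rw [isKTuple_iff]
  intro x
  obtain ⟨i, hi⟩ := exists_nonneg_of_sum_zero (hs x)
  exact ⟨i, fun hx => absurd hx.2 (not_lt.mpr hi)⟩

lemma abs_sum_lt {k : ℕ} {a : Fin k → ℝ} {ε : ℝ} (hε : 0 < ε) (h : ∀ i, |a i| < ε) :
    |∑ i, a i| < (k + 1) * ε := by
  calc |∑ i, a i| ≤ ∑ i, |a i| := Finset.abs_sum_le_sum_abs _ _
    _ ≤ ∑ _i : Fin k, ε := Finset.sum_le_sum fun i _ => (h i).le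
    _ = k * ε := by simp
    _ < (k + 1) * ε := by nlinarith

lemma xt_close {k : ℕ} {v w : Fin k → ℝ} {ε : ℝ} (hε : 0 < ε) (h : ∀ i, |v i - w i| < ε)
    (i : Fin (k + 1)) : |xt v i - xt w i| < (k + 1) * ε := by
  refine Fin.cases ?_ (fun i => ?_) i
  · rw [xt_zero, xt_zero]
    have : -∑ i, v i - -∑ i, w i = -∑ i, (v i - w i) := by
      rw [Finset.sum_sub_distrib]; ring
    rw [this, abs_neg]
    exact abs_sum_lt hε h
  · rw [xt_succ, xt_succ]
    have := h i
    have hk : (0 : ℝ) ≤ k := Nat.cast_nonneg k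
    nlinarith

/-- Instability gives an upper bound for `∂Δ^k-dim`. -/
lemma kDimLE_of_unst {k n : ℕ} {Y : Type} [TopologicalSpace Y] [NormalSpace Y]
    (h : UnstOn (univ : Set Y) (Fin (n + 1) × Fin k)) : KDimLE (bComplex k) Y n := by
  intro F hF hK
  choose b hb1 hb2 using fun j => bary (F j) (hF j) (hK j)
  have hε : (0 : ℝ) < 1 / (k + 1) := by positivity
  obtain ⟨g, hg1, hg2⟩ := h ⟨fun x p => b p.1 x p.2.succ, by fun_prop⟩ (1 / (k + 1)) hε
  let G : Fin (n + 1) → C(Y, Fin (k + 1) → ℝ) := fun j =>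
    ⟨fun x => xt (fun i => g x (j, i)), by fun_prop⟩
  have hG : ∀ j x i, |G j x i - b j x i| < 1 := by
    intro j x i
    have := xt_close hε (v := fun i => g x (j, i)) (w := fun i => b j x i.succ)
      (fun i => hg1 x (j, i)) i
    rw [xt_tail _ (hb1 j x)] at this
    have e : ((k : ℝ) + 1) * (1 / (k + 1)) = 1 := by field_simp
    rw [e] at this
    exact this
  refine ⟨fun j i => {x | x ∈ (Set.univ : Set Y) ∧ G j x i < 0}, fun j => ⟨fun i => ?_, ?_, ?_⟩, ?_⟩
  · simp only [mem_univ, true_and]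
    exact isOpen_lt (by fun_prop) continuous_const
  · exact tuple_of_fun _ (fun x => xt_sum _) _
  · intro i x hx
    refine ⟨trivial, ?_⟩
    have h1 := hG j x i
    rw [hb2 j i x hx, abs_lt] at h1
    linarith [h1.2]
  · rw [eq_empty_iff_forall_notMem]
    intro x hx
    simp only [mem_iInter, mem_compl_iff, mem_iUnion] at hx
    apply hg2 x trivial
    funext ⟨j, i⟩
    by_contra hne
    have hv : (fun i => g x (j, i)) ≠ 0 := fun h0 => hne (congrFun h0 i)
    obtain ⟨l, hl⟩ := exists_neg_of_sum_zero (xt_sum _) (xt_ne_zero hv)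
    exact hx j ⟨l, trivial, hl⟩

lemma exists_cozero {Y : Type} [TopologicalSpace Y] [TopologicalSpace.MetrizableSpace Y]
    {U : Set Y} (hU : IsOpen U) :
    ∃ u : C(Y, ℝ), (∀ x, 0 ≤ u x ∧ u x ≤ 1) ∧ ∀ x, 0 < u x ↔ x ∈ U := by
  letI := TopologicalSpace.metrizableSpaceMetric Y
  by_cases hne : (Uᶜ).Nonempty
  · refine ⟨⟨fun x => min 1 (Metric.infDist x Uᶜ), ?_⟩, fun x => ⟨?_, ?_⟩, fun x => ?_⟩
    · exact continuous_const.min (Metric.continuous_infDist_pt _)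
    · exact le_min zero_le_one Metric.infDist_nonneg
    · exact min_le_left _ _
    · simp only [ContinuousMap.coe_mk, lt_min_iff, zero_lt_one, true_and]
      rw [← hU.isClosed_compl.notMem_iff_infDist_pos hne]
      simp
  · have : U = Set.univ := by
      rw [Set.not_nonempty_iff_eq_empty, compl_empty_iff] at hne
      exact hne
    exact ⟨1, by simp, by simp [this]⟩

/-- From partitions back to perturbations. -/
lemma lemmaA {k : ℕ} {Y : Type} [TopologicalSpace Y] [TopologicalSpace.MetrizableSpace Y]
    (f : C(Y, Fin k → ℝ)) (ε : ℝ) (hε : 0 < ε) :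
    ∃ F : Fin (k + 1) → Set Y, (∀ i, IsClosed (F i)) ∧ IsKTuple (bComplex k) F ∧
      ∀ U : Fin (k + 1) → Set Y, KNbhd (bComplex k) F U →
        ∃ g : C(Y, Fin k → ℝ), (∀ x i, |g x i - f x i| < ε) ∧
          ∀ x, g x = 0 → x ∈ (⋃ i, U i)ᶜ := by
  obtain ⟨δ, hδ, hδε⟩ : ∃ δ > 0, (2 * k + 4) * δ < ε := by
    refine ⟨ε / (2 * k + 5), by positivity, ?_⟩
    rw [mul_div_assoc', div_lt_iff₀ (by positivity)]
    nlinarith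
  let h : C(Y, Fin (k + 1) → ℝ) := ⟨fun x => xt (f x), by fun_prop⟩
  have hsum : ∀ x, ∑ i, h x i = 0 := fun x => xt_sum _
  refine ⟨fun i => {x | h x i ≤ -δ}, fun i => isClosed_le (by fun_prop) continuous_const, ?_, ?_⟩
  · rw [isKTuple_iff]
    intro x
    obtain ⟨i, hi⟩ := exists_nonneg_of_sum_zero (hsum x)
    refine ⟨i, fun hx => ?_⟩
    have : h x i ≤ -δ := hx
    linarith
  rintro U ⟨hU1, hU2, hU3⟩
  rw [isKTuple_iff] at hU2
  choose u hu1 hu2 using fun i => exists_cozero (hU1 i)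
  let m : Y → ℝ := fun x => Finset.univ.inf' Finset.univ_nonempty (fun i => h x i)
  have hm : Continuous m := Continuous.finset_inf'_apply _ fun i _ => by fun_prop
  have hmle : ∀ x i, m x ≤ h x i := fun x i => Finset.inf'_le _ (Finset.mem_univ i)
  have hmex : ∀ x, ∃ i, h x i = m x := fun x => by
    obtain ⟨i, -, hi⟩ := Finset.exists_mem_eq_inf' Finset.univ_nonempty (fun i => h x i)
    exact ⟨i, hi.symm⟩
  let t : Y → ℝ := fun x => max 0 (min 1 ((-m x - δ) / δ))
  have ht : Continuous t := by fun_prop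
  have ht0 : ∀ x, 0 ≤ t x := fun x => le_max_left _ _
  have ht1 : ∀ x, t x ≤ 1 := fun x => max_le zero_le_one (min_le_left _ _)
  have htpos : ∀ x, 0 < t x → m x < -δ := by
    intro x hx
    have : 0 < (-m x - δ) / δ := by
      by_contra hcon
      push Not at hcon
      have : t x = 0 := max_eq_left ((min_le_right _ _).trans hcon)
      linarith
    rw [div_pos_iff_of_pos_right hδ] at this
    linarith
  have htlt : ∀ x, t x < 1 → -(2 * δ) < m x := by
    intro x hx
    by_contra hcon
    push Not at hcon
    have : 1 ≤ (-m x - δ) / δ := by rw [le_div_iff₀ hδ]; linarith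
    have : t x = 1 := by
      simp only [t]
      rw [min_eq_left this]; simp
    linarith
  let M : Y → ℝ := fun x => (∑ i, u i x) / (k + 1)
  have hM : Continuous M := by fun_prop
  have hM01 : ∀ x, 0 ≤ M x ∧ M x ≤ 1 := by
    intro x
    constructor
    · exact div_nonneg (Finset.sum_nonneg fun i _ => (hu1 i x).1) (by positivity)
    · rw [div_le_one (by positivity)]
      calc ∑ i, u i x ≤ ∑ _i : Fin (k + 1), (1 : ℝ) := Finset.sum_le_sum fun i _ => (hu1 i x).2
        _ = k + 1 := by simp
  let G : Y → Fin (k + 1) → ℝ := fun x i => t x * h x i + (1 - t x) * (δ * (M x - u i x))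
  have hGc : Continuous G := by fun_prop
  have hGs : ∀ x, ∑ i, G x i = 0 := by
    intro x
    simp only [G, Finset.sum_add_distrib, ← Finset.mul_sum, hsum, Finset.sum_sub_distrib]
    simp only [M]
    have : (Finset.univ : Finset (Fin (k+1))).card = k + 1 := by simp
    simp only [Finset.sum_const, this, nsmul_eq_mul]
    push_cast
    field_simp
    ring
  have hGh : ∀ x i, |G x i - h x i| < ε := by
    intro x i
    rcases (ht1 x).lt_or_eq with hlt | heq
    · have hm2 := htlt x hlt
      have hlow : ∀ i, -(2 * δ) < h x i := fun i => lt_of_lt_of_le hm2 (hmle x i)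
      have hup : h x i ≤ 2 * k * δ := by
        have h1 := hsum x
        rw [← Finset.add_sum_erase _ _ (Finset.mem_univ i)] at h1
        have h2 : ∑ j ∈ Finset.univ.erase i, (-(2 * δ)) ≤ ∑ j ∈ Finset.univ.erase i, h x j :=
          Finset.sum_le_sum fun j _ => (hlow j).le
        rw [Finset.sum_const, Finset.card_erase_of_mem (Finset.mem_univ i)] at h2
        simp only [Finset.card_univ, Fintype.card_fin, Nat.add_sub_cancel, nsmul_eq_mul] at h2
        nlinarith
      have e : G x i - h x i = (1 - t x) * (δ * (M x - u i x) - h x i) := by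
        simp only [G]; ring
      rw [e, abs_mul, abs_of_nonneg (by linarith)]
      have hk0 : (0 : ℝ) ≤ k := Nat.cast_nonneg k
      have b1 : |δ * (M x - u i x) - h x i| ≤ (2 * k + 4) * δ := by
        have c1 : M x - u i x ≤ 1 := by linarith [(hM01 x).2, (hu1 i x).1]
        have c2 : -1 ≤ M x - u i x := by linarith [(hM01 x).1, (hu1 i x).2]
        have c3 := hlow i
        rw [abs_le]
        constructor <;> nlinarith
      calc (1 - t x) * |δ * (M x - u i x) - h x i| ≤ 1 * |δ * (M x - u i x) - h x i| :=
            mul_le_mul_of_nonneg_right (by linarith [ht0 x]) (abs_nonneg _)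
        _ < ε := by linarith
    · simp only [G, heq]
      simpa using hε
  refine ⟨⟨fun x i => G x i.succ, by fun_prop⟩, fun x i => ?_, fun x h0 => ?_⟩
  · have := hGh x i.succ
    have e : h x i.succ = f x i := xt_succ _ _
    rw [e] at this
    exact this
  · have hG0 : ∀ i, G x i = 0 := by
      intro i
      have e : (fun i : Fin k => G x i.succ) = 0 := h0
      rw [← xt_tail (G x) (hGs x), e]
      refine Fin.cases ?_ (fun i => ?_) i
      · simp [xt_zero]
      · simp [xt_succ]
    obtain ⟨j, hj⟩ := hU2 x
    have huj : u j x = 0 := le_antisymm (not_lt.mp fun hp => hj ((hu2 j x).mp hp)) (hu1 j x).1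
    rcases (ht0 x).eq_or_lt with heq | hlt
    · have hall : ∀ i, u i x = M x := by
        intro i
        have := hG0 i
        simp only [G, ← heq, zero_mul, zero_add, sub_zero, one_mul] at this
        rcases mul_eq_zero.mp this with h | h
        · linarith
        · linarith
      simp only [mem_compl_iff, mem_iUnion, not_exists]
      intro i hi
      have := (hu2 i x).mpr hi
      rw [hall i, ← hall j, huj] at this
      exact lt_irrefl _ this
    · exfalso
      have hm1 := htpos x hlt
      obtain ⟨i, hi⟩ := hmex x
      have hxF : x ∈ U i := hU3 i (show h x i ≤ -δ by rw [hi]; linarith)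
      have hui := (hu2 i x).mpr hxF
      have g1 := hG0 i
      have g2 := hG0 j
      simp only [G, huj] at g1 g2
      have hle : h x i ≤ h x j := by rw [hi]; exact hmle x j
      have h3 : t x * (h x j - h x i) + (1 - t x) * (δ * u i x) = 0 := by linarith
      have h4 : 0 ≤ t x * (h x j - h x i) := mul_nonneg hlt.le (by linarith)
      have h5 : 0 ≤ (1 - t x) * (δ * u i x) :=
        mul_nonneg (by linarith [ht1 x]) (by positivity)
      have h6 : (1 - t x) * (δ * u i x) = 0 := by linarith
      have h7 : 1 - t x = 0 := by
        rcases mul_eq_zero.mp h6 with h | h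
        · exact h
        · have : 0 < δ * u i x := by positivity
          linarith
      rw [h7] at g1
      have h8 : t x * h x i = 0 := by linarith
      rcases mul_eq_zero.mp h8 with h | h
      · linarith
      · linarith

open Filter in
/-- A Baire category argument. -/
lemma baire_zero {Y : Type} [TopologicalSpace Y] [CompactSpace Y]
    [TopologicalSpace.MetrizableSpace Y] {J J' : Type} [Fintype J] [Fintype J']
    (h : UnstOn (univ : Set Y) (J ⊕ J')) (f0 : C(Y, J → ℝ)) (ε : ℝ) (hε : 0 < ε) :
    ∃ f : C(Y, J → ℝ), (∀ x j, |f x j - f0 x j| < ε) ∧ UnstOn {x | f x = 0} J' := by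
  letI := TopologicalSpace.metrizableSpaceMetric Y
  let O : ℕ → ℕ → Set C(Y, J → ℝ) := fun m n =>
    {f | ∃ g : C(Y, J' → ℝ), dist g (TopologicalSpace.denseSeq C(Y, J' → ℝ) m) < 1 / ((n : ℝ) + 1) ∧
      ∀ x, f x = 0 → g x ≠ 0}
  have hopen : ∀ m n, IsOpen (O m n) := by
    intro m n
    rw [isOpen_iff_mem_nhds]
    rintro f ⟨g, hg1, hg2⟩
    have hcpt : IsCompact {x | g x = 0} :=
      (isClosed_eq g.continuous continuous_const).isCompact
    have ho : IsOpen {f' : C(Y, J → ℝ) | MapsTo f' {x | g x = 0} ({0}ᶜ : Set (J → ℝ))} :=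
      ContinuousMap.isOpen_setOf_mapsTo hcpt isOpen_compl_singleton
    refine mem_of_superset (ho.mem_nhds ?_) ?_
    · intro x hx hfx
      exact hg2 x hfx hx
    · intro f' hf'
      exact ⟨g, hg1, fun x hx hgx => hf' hgx hx⟩
  have hdense : ∀ m n, Dense (O m n) := by
    intro m n
    rw [Metric.dense_iff]
    intro f r hr
    set q := TopologicalSpace.denseSeq C(Y, J' → ℝ) m
    let δ := min (r / 2) (1 / ((n : ℝ) + 1) / 2)
    have hδ : 0 < δ := by positivity
    obtain ⟨g, hg1, hg2⟩ := h ⟨fun x => Sum.elim (f x) (q x), by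
      refine continuous_pi fun j => ?_
      rcases j with j | j
      · simp only [Sum.elim_inl]; fun_prop
      · simp only [Sum.elim_inr]; fun_prop⟩ δ hδ
    refine ⟨⟨fun x j => g x (Sum.inl j), by fun_prop⟩, ?_, ⟨fun x j => g x (Sum.inr j), by fun_prop⟩,
      ?_, ?_⟩
    · rw [Metric.mem_ball]
      refine lt_of_le_of_lt ((ContinuousMap.dist_le hδ.le).mpr fun x => ?_)
        (show δ < r from lt_of_le_of_lt (min_le_left _ _) (by linarith))
      rw [dist_pi_le_iff hδ.le]
      intro j
      exact (hg1 x (Sum.inl j)).le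
    · have hp : (0 : ℝ) < 1 / ((n : ℝ) + 1) := by positivity
      refine lt_of_le_of_lt ((ContinuousMap.dist_le hδ.le).mpr fun x => ?_)
        (show δ < 1 / ((n : ℝ) + 1) from lt_of_le_of_lt (min_le_right _ _) (by linarith))
      rw [dist_pi_le_iff hδ.le]
      intro j
      exact (hg1 x (Sum.inr j)).le
    · intro x h1 h2
      apply hg2 x trivial
      funext j
      rcases j with j | j
      · exact congrFun h1 j
      · exact congrFun h2 j
  have hD : Dense (⋂ p : ℕ × ℕ, O p.1 p.2) :=
    dense_iInter_of_isOpen (fun p => hopen p.1 p.2) (fun p => hdense p.1 p.2)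
  obtain ⟨f, hf1, hf2⟩ := hD.exists_dist_lt f0 hε
  refine ⟨f, fun x j => ?_, ?_⟩
  · rw [← Real.dist_eq]
    refine lt_of_le_of_lt ((dist_le_pi_dist _ _ j).trans ?_) hf2
    rw [dist_comm f0]
    exact ContinuousMap.dist_apply_le_dist x
  · intro q η hη
    obtain ⟨n, hn⟩ := exists_nat_one_div_lt (show (0 : ℝ) < η / 2 by positivity)
    obtain ⟨m, hm⟩ := (TopologicalSpace.denseRange_denseSeq C(Y, J' → ℝ)).exists_dist_lt q
      (show (0 : ℝ) < η / 2 by positivity)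
    obtain ⟨g, hg1, hg2⟩ := mem_iInter.mp hf1 (m, n)
    refine ⟨g, fun x j => ?_, fun x hx => hg2 x hx⟩
    have hd : dist g q < η := by
      calc dist g q ≤ dist g (TopologicalSpace.denseSeq C(Y, J' → ℝ) m) +
            dist (TopologicalSpace.denseSeq C(Y, J' → ℝ) m) q := dist_triangle _ _ _
        _ < η := by
          rw [dist_comm _ q]
          have := hg1
          simp only at this
          linarith
    rw [← Real.dist_eq]
    exact lt_of_le_of_lt ((dist_le_pi_dist _ _ j).trans (ContinuousMap.dist_apply_le_dist x)) hd

/-- Real-valued version of the Baire argument. -/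
lemma baire_real {Y : Type} [TopologicalSpace Y] [CompactSpace Y]
    [TopologicalSpace.MetrizableSpace Y] {e : ℕ}
    (h : UnstOn (univ : Set Y) (Fin (e + 1))) (f0 : C(Y, ℝ)) (ε : ℝ) (hε : 0 < ε) :
    ∃ f : C(Y, ℝ), (∀ x, |f x - f0 x| < ε) ∧ UnstOn {x | f x = 0} (Fin e) := by
  obtain ⟨f, hf1, hf2⟩ := baire_zero (J := Unit) (J' := Fin e)
    (h.of_card_le (by simp [add_comm])) ⟨fun x _ => f0 x, by fun_prop⟩ ε hε
  refine ⟨⟨fun x => f x (), by fun_prop⟩, fun x => hf1 x (), hf2.mono fun x hx => ?_⟩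
  funext j
  exact hx

/-- The sphere `S^{k-1}`. -/
abbrev Sph (k : ℕ) : Type := ↥(Metric.sphere (0 : EuclideanSpace ℝ (Fin k)) 1)

lemma kIndLE_iff {m : ℕ} {K : Finset (Fin m) → Prop} {X : Type} [TopologicalSpace X]
    {α : Ordinal.{0}} : KIndLE K X α ↔
    ∀ F : Fin m → Set X, (∀ i, IsClosed (F i)) → IsKTuple K F →
      ∃ U : Fin m → Set X, KNbhd K F U ∧
        ((⋃ i, U i)ᶜ = (∅ : Set X) ∨ ∃ β < α, KIndLE K (↥((⋃ i, U i)ᶜ)) β) := by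
  unfold KIndLE KIndLeAux
  rw [WellFounded.fix_eq]
  constructor
  · intro h F h1 h2
    obtain ⟨U, u1, u2, u3, u4⟩ := h F h1 h2
    refine ⟨U, ⟨u1, u2, u3⟩, u4.imp id ?_⟩
    rintro ⟨β, hβ⟩
    exact ⟨β.1, β.2, hβ⟩
  · intro h F h1 h2
    obtain ⟨U, ⟨u1, u2, u3⟩, u4⟩ := h F h1 h2
    refine ⟨U, u1, u2, u3, u4.imp id ?_⟩
    rintro ⟨β, hβ, hβ2⟩
    exact ⟨⟨β, hβ⟩, hβ2⟩

lemma lIndLE_iff {L : Type} [TopologicalSpace L] {X : Type} [TopologicalSpace X]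
    {α : Ordinal.{0}} : LIndLE L X α ↔
    ∀ F : Set X, IsClosed F → ∀ f : C(F, L),
      ∃ U : Set X, IsOpen U ∧ ∃ hFU : F ⊆ U,
        (∃ g : C(U, L), ∀ (x : X) (hx : x ∈ F), g ⟨x, hFU hx⟩ = f ⟨x, hx⟩) ∧
        (Uᶜ = (∅ : Set X) ∨ ∃ β < α, LIndLE L (↥(Uᶜ)) β) := by
  unfold LIndLE LIndLeAux
  rw [WellFounded.fix_eq]
  constructor
  · intro h F h1 h2
    obtain ⟨U, u1, u2, u3, u4⟩ := h F h1 h2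
    refine ⟨U, u1, u2, u3, u4.imp id ?_⟩
    rintro ⟨β, hβ⟩
    exact ⟨β.1, β.2, hβ⟩
  · intro h F h1 h2
    obtain ⟨U, u1, u2, u3, u4⟩ := h F h1 h2
    refine ⟨U, u1, u2, u3, u4.imp id ?_⟩
    rintro ⟨β, hβ, hβ2⟩
    exact ⟨⟨β, hβ⟩, hβ2⟩

lemma KIndLE.mono {m : ℕ} {K : Finset (Fin m) → Prop} {X : Type} [TopologicalSpace X]
    {α β : Ordinal.{0}} (h : KIndLE K X α) (hab : α ≤ β) : KIndLE K X β := by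
  rw [kIndLE_iff] at h ⊢
  intro F h1 h2
  obtain ⟨U, u1, u2⟩ := h F h1 h2
  refine ⟨U, u1, u2.imp id ?_⟩
  rintro ⟨γ, hγ, hγ2⟩
  exact ⟨γ, hγ.trans_le hab, hγ2⟩

lemma KIndLE.closedEmbedding {k : ℕ} {α : Ordinal.{0}} : ∀ {Y Y' : Type} [TopologicalSpace Y]
    [TopologicalSpace Y'] {e : Y → Y'}, IsClosedEmbedding e → KIndLE (bComplex k) Y' α →
    KIndLE (bComplex k) Y α := by
  induction α using WellFoundedLT.induction with
  | ind α ih =>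
    intro Y Y' _ _ e he h
    rw [kIndLE_iff] at h ⊢
    intro F h1 h2
    rw [isKTuple_iff] at h2
    obtain ⟨U, ⟨u1, u2, u3⟩, u4⟩ := h (fun i => e '' (F i)) (fun i => he.isClosedMap _ (h1 i)) (by
      rw [isKTuple_iff]
      intro y
      by_cases hy : y ∈ range e
      · obtain ⟨x, rfl⟩ := hy
        obtain ⟨i, hi⟩ := h2 x
        refine ⟨i, ?_⟩
        rintro ⟨x', hx', hxx⟩
        exact hi (he.injective hxx ▸ hx')
      · exact ⟨0, fun ⟨x, _, hx⟩ => hy ⟨x, hx⟩⟩)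
    rw [isKTuple_iff] at u2
    have hEq : (⋃ i, e ⁻¹' (U i))ᶜ = e ⁻¹' ((⋃ i, U i)ᶜ) := by
      rw [preimage_compl, preimage_iUnion]
    refine ⟨fun i => e ⁻¹' (U i), ⟨fun i => (u1 i).preimage he.continuous, ?_, ?_⟩, ?_⟩
    · rw [isKTuple_iff]
      intro x
      exact u2 (e x)
    · intro i x hx
      exact u3 i ⟨x, hx, rfl⟩
    · rcases u4 with u4 | ⟨β, hβ, u4⟩
      · left
        rw [hEq, u4, preimage_empty]
      · right
        refine ⟨β, hβ, ?_⟩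
        rw [hEq]
        exact ih β hβ (he.restrictPreimage ((⋃ i, U i)ᶜ)) u4

lemma KIndLE.subset {k : ℕ} {α : Ordinal.{0}} {X : Type} [TopologicalSpace X] {P : Set X}
    (hP : IsClosed P) (h : KIndLE (bComplex k) X α) : KIndLE (bComplex k) P α :=
  h.closedEmbedding hP.isClosedEmbedding_subtypeVal

/-- Normalisation to the sphere. -/
def toSph {k : ℕ} (v : Fin k → ℝ) (hv : v ≠ 0) : Sph k :=
  ⟨(‖(WithLp.toLp 2 v : EuclideanSpace ℝ (Fin k))‖)⁻¹ • (WithLp.toLp 2 v), by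
    have : ‖(WithLp.toLp 2 v : EuclideanSpace ℝ (Fin k))‖ ≠ 0 := by
      rw [norm_ne_zero_iff]
      intro h
      apply hv
      funext i
      have := congrArg (fun w : EuclideanSpace ℝ (Fin k) => w i) h
      simpa using this
    rw [mem_sphere_zero_iff_norm, norm_smul, norm_inv, norm_norm, inv_mul_cancel₀ this]⟩

lemma toSph_apply {k : ℕ} (v : Fin k → ℝ) (hv : v ≠ 0) (i : Fin k) :
    (toSph v hv).1 i = (‖(WithLp.toLp 2 v : EuclideanSpace ℝ (Fin k))‖)⁻¹ * v i := by
  simp [toSph]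

lemma toLp_norm_pos {k : ℕ} {v : Fin k → ℝ} (hv : v ≠ 0) :
    0 < ‖(WithLp.toLp 2 v : EuclideanSpace ℝ (Fin k))‖ := by
  rw [norm_pos_iff]
  intro h
  apply hv
  funext i
  have := congrArg (fun w : EuclideanSpace ℝ (Fin k) => w i) h
  simpa using this

lemma continuous_toSph {k : ℕ} {X : Type} [TopologicalSpace X] (g : X → Fin k → ℝ)
    (hg : Continuous g) (h0 : ∀ x, g x ≠ 0) : Continuous (fun x => toSph (g x) (h0 x)) := by
  refine Continuous.subtype_mk ?_ _
  have h1 : Continuous fun x => (WithLp.toLp 2 (g x) : EuclideanSpace ℝ (Fin k)) :=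
    (PiLp.continuous_toLp 2 _).comp hg
  exact (h1.norm.inv₀ fun x => (toLp_norm_pos (h0 x)).ne').smul h1

lemma sph_ne_zero {k : ℕ} (s : Sph k) : (fun i => s.1 i) ≠ (0 : Fin k → ℝ) := by
  intro h
  have h1 : s.1 = 0 := by
    ext i
    exact congrFun h i
  have h2 := s.2
  rw [mem_sphere_zero_iff_norm, h1] at h2
  simp at h2

lemma toSph_self {k : ℕ} (s : Sph k) (v : Fin k → ℝ) (hv : v ≠ 0) (h : ∀ i, v i = s.1 i) :
    toSph v hv = s := by
  have e : (WithLp.toLp 2 v : EuclideanSpace ℝ (Fin k)) = s.1 := by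
    ext i
    exact h i
  apply Subtype.ext
  simp only [toSph]
  rw [e]
  have := s.2
  rw [mem_sphere_zero_iff_norm] at this
  rw [this]; simp

lemma xt_smul {k : ℕ} (c : ℝ) (v : Fin k → ℝ) (i : Fin (k + 1)) :
    xt (fun j => c * v j) i = c * xt v i := by
  refine Fin.cases ?_ (fun i => ?_) i
  · rw [xt_zero, xt_zero, ← Finset.mul_sum]; ring
  · rw [xt_succ, xt_succ]

lemma KIndLE.of_lIndLE {k : ℕ} {α : Ordinal.{0}} : ∀ {Y : Type} [TopologicalSpace Y]
    [NormalSpace Y], LIndLE (Sph k) Y α → KIndLE (bComplex k) Y α := by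
  induction α using WellFoundedLT.induction with
  | ind α ih =>
    intro Y _ _ h
    rw [lIndLE_iff] at h
    rw [kIndLE_iff]
    intro F h1 h2
    obtain ⟨b, hb1, hb2⟩ := bary F h1 h2
    have hne : ∀ x ∈ ⋃ i, F i, (fun i : Fin k => b x i.succ) ≠ 0 := by
      intro x hx h0
      obtain ⟨i, hi⟩ := mem_iUnion.mp hx
      have e := xt_tail (b x) (hb1 x)
      rw [h0] at e
      have e2 := congrFun e i
      rw [hb2 i x hi] at e2
      have : xt (0 : Fin k → ℝ) i = 0 := by
        refine Fin.cases ?_ (fun i => ?_) i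
        · simp [xt_zero]
        · simp [xt_succ]
      linarith
    obtain ⟨U, hU, hFU, ⟨g, hg⟩, hP⟩ := h (⋃ i, F i) (isClosed_iUnion_of_finite h1)
      ⟨fun x => toSph (fun i : Fin k => b x i.succ) (hne x x.2),
        continuous_toSph _ (by fun_prop) _⟩
    let G : U → Fin (k + 1) → ℝ := fun x => xt (fun i => (g x).1 i)
    have hG : Continuous G := by
      refine continuous_xt.comp (continuous_pi fun i => ?_)
      exact (EuclideanSpace.proj (𝕜 := ℝ) i).continuous.comp (continuous_subtype_val.comp g.continuous)
    have hun : (⋃ i, ((↑) : U → Y) '' {x | G x i < 0}) = U := by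
      apply Subset.antisymm
      · exact iUnion_subset fun i => by rintro _ ⟨x, -, rfl⟩; exact x.2
      · intro x hx
        obtain ⟨i, hi⟩ := exists_neg_of_sum_zero (xt_sum _) (xt_ne_zero (sph_ne_zero (g ⟨x, hx⟩)))
        exact mem_iUnion.mpr ⟨i, ⟨x, hx⟩, hi, rfl⟩
    refine ⟨fun i => ((↑) : U → Y) '' {x | G x i < 0}, ⟨fun i => ?_, ?_, ?_⟩, ?_⟩
    · exact hU.isOpenMap_subtype_val _ (isOpen_lt (by fun_prop) continuous_const)
    · rw [isKTuple_iff]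
      intro x
      by_cases hx : x ∈ U
      · obtain ⟨i, hi⟩ := exists_nonneg_of_sum_zero (xt_sum (fun i => (g ⟨x, hx⟩).1 i))
        refine ⟨i, ?_⟩
        rintro ⟨y, hy, rfl⟩
        exact absurd hy (not_lt.mpr hi)
      · exact ⟨0, by rintro ⟨y, hy, rfl⟩; exact hx y.2⟩
    · intro i x hx
      have hx' : x ∈ ⋃ i, F i := mem_iUnion.mpr ⟨i, hx⟩
      refine ⟨⟨x, hFU hx'⟩, ?_, rfl⟩
      have e := hg x hx'
      simp only [mem_ofPred_eq, G]
      rw [e]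
      simp only [ContinuousMap.coe_mk, toSph_apply]
      rw [xt_smul, xt_tail _ (hb1 x), hb2 i x hx]
      have := inv_pos.mpr (toLp_norm_pos (hne x hx'))
      linarith
    · rw [hun]
      refine hP.imp id ?_
      rintro ⟨β, hβ, hβ2⟩
      have : NormalSpace ↥Uᶜ := hU.isClosed_compl.isClosedEmbedding_subtypeVal.normalSpace
      exact ⟨β, hβ, ih β hβ hβ2⟩

/-- Upper bound for the inductive dimension modulo a sphere. -/
lemma lIndLE_of_unst {k : ℕ} (n : ℕ) : ∀ {Y : Type} [TopologicalSpace Y] [CompactSpace Y]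
    [TopologicalSpace.MetrizableSpace Y], UnstOn (univ : Set Y) (Fin (n + 1) × Fin k) →
    LIndLE (Sph k) Y (n : Ordinal.{0}) := by
  induction n with
  | zero => ?_
  | succ n ih => ?_
  all_goals
    intro Y _ _ _ h
    rw [lIndLE_iff]
    intro F hF f
  case' zero => obtain ⟨N, hN⟩ : ∃ N, N = 0 := ⟨_, rfl⟩
  case' succ => obtain ⟨N, hN⟩ : ∃ N, N = n + 1 := ⟨_, rfl⟩
  all_goals
    have h' : UnstOn (univ : Set Y) (Fin k ⊕ Fin N × Fin k) := h.of_card_le (by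
      subst hN
      simp only [Fintype.card_prod, Fintype.card_fin, Fintype.card_sum]
      ring_nf
      rfl)
    obtain ⟨ft, -, hft⟩ := extend_small hF.isClosedEmbedding_subtypeVal
      (⟨fun x i => (f x).1 i, continuous_pi fun i =>
        (EuclideanSpace.proj (𝕜 := ℝ) i).continuous.comp (continuous_subtype_val.comp f.continuous)⟩ :
        C(F, Fin k → ℝ)) (t := Set.univ) ⟨0, trivial⟩ (fun _ _ => trivial)
    have hftn : ∀ x ∈ F, ft x ≠ 0 := by
      intro x hx h0
      have := hft ⟨x, hx⟩
      simp only [h0] at this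
      exact sph_ne_zero (f ⟨x, hx⟩) this.symm
    obtain ⟨δ, hδ, hδ2⟩ := exists_pos_bound hF.isCompact ft hftn
    obtain ⟨g', hg1, hg2⟩ := baire_zero h' ft (δ / 4) (by positivity)
    let lam : Y → ℝ := fun x => max 0 (min 1 (2 - 2 * ‖ft x‖ / δ))
    have hlam : Continuous lam := by fun_prop
    have hl0 : ∀ x, 0 ≤ lam x := fun x => le_max_left _ _
    have hl1 : ∀ x, lam x ≤ 1 := fun x => max_le zero_le_one (min_le_left _ _)
    have hlF : ∀ x ∈ F, lam x = 0 := by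
      intro x hx
      obtain ⟨j, hj⟩ := hδ2 x hx
      have h1 : δ ≤ ‖ft x‖ := hj.trans (norm_le_pi_norm (ft x) j)
      apply max_eq_left
      refine (min_le_right _ _).trans ?_
      have : 1 ≤ ‖ft x‖ / δ := by rw [le_div_iff₀ hδ]; linarith
      have e : 2 * ‖ft x‖ / δ = 2 * (‖ft x‖ / δ) := by ring
      linarith
    have hllt : ∀ x, lam x < 1 → δ / 2 < ‖ft x‖ := by
      intro x hx
      by_contra hcon
      push Not at hcon
      have : ‖ft x‖ / δ ≤ 1 / 2 := by rw [div_le_iff₀ hδ]; linarith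
      have e : 2 * ‖ft x‖ / δ = 2 * (‖ft x‖ / δ) := by ring
      have : lam x = 1 := by
        simp only [lam]
        rw [min_eq_left (by linarith)]; simp
      linarith
    let g : Y → Fin k → ℝ := fun x i => ft x i + lam x * (g' x i - ft x i)
    have hg : Continuous g := by fun_prop
    have hg0 : ∀ x, g x = 0 → g' x = 0 := by
      intro x hx
      rcases (hl1 x).lt_or_eq with hlt | heq
      · exfalso
        have h1 := hllt x hlt
        have h2 : ‖ft x‖ ≤ δ / 4 := by
          rw [pi_norm_le_iff_of_nonneg (by positivity)]
          intro i
          have h3 := congrFun hx i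
          simp only [g, Pi.zero_apply] at h3
          have h4 : ft x i = -(lam x * (g' x i - ft x i)) := by linarith
          rw [h4, norm_neg, norm_mul, Real.norm_eq_abs, Real.norm_eq_abs, abs_of_nonneg (hl0 x)]
          calc lam x * |g' x i - ft x i| ≤ 1 * |g' x i - ft x i| :=
                mul_le_mul_of_nonneg_right (hl1 x) (abs_nonneg _)
            _ ≤ δ / 4 := by rw [one_mul]; exact (hg1 x i).le
        linarith
      · funext i
        have h3 := congrFun hx i
        simp only [g, heq, Pi.zero_apply] at h3
        simp only [Pi.zero_apply]
        linarith
    have hFne : ∀ x ∈ F, g x = ft x := by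
      intro x hx
      funext i
      simp [g, hlF x hx]
    have hUo : IsOpen {x | g x ≠ 0} := isOpen_ne_fun hg continuous_const
    have hFU : F ⊆ {x | g x ≠ 0} := fun x hx => by
      rw [mem_ofPred_eq, hFne x hx]; exact hftn x hx
    refine ⟨{x | g x ≠ 0}, hUo, hFU,
      ⟨⟨fun x => toSph (g x.1) x.2, continuous_toSph _ (by fun_prop) _⟩, ?_⟩, ?_⟩
    · intro x hx
      refine toSph_self _ _ (hFU hx) fun i => ?_
      change g x i = _
      rw [hFne x hx]
      exact congrFun (hft ⟨x, hx⟩) i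
    have hUn : UnstOn {x | g x ≠ 0}ᶜ (Fin N × Fin k) := hg2.mono (by
      intro x hx
      simp only [mem_compl_iff, mem_ofPred_eq, not_not] at hx
      exact hg0 x hx)
    subst hN
  case zero =>
    left
    exact hUn.eq_empty
  case succ =>
    right
    refine ⟨n, by exact_mod_cast Nat.lt_succ_self n, ?_⟩
    have : CompactSpace ↥{x | g x ≠ 0}ᶜ := isCompact_iff_compactSpace.mp hUo.isClosed_compl.isCompact
    exact ih (hUn.subtype hUo.isClosed_compl)

/-- Combining a partition for the first block with instability for the rest. -/
lemma combine {k : ℕ} {Y : Type} [TopologicalSpace Y] [TopologicalSpace.MetrizableSpace Y]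
    {J' : Type} [Fintype J']
    (h : ∀ F : Fin (k + 1) → Set Y, (∀ i, IsClosed (F i)) → IsKTuple (bComplex k) F →
      ∃ U, KNbhd (bComplex k) F U ∧ UnstOn (⋃ i, U i)ᶜ J') :
    UnstOn (univ : Set Y) (Fin k ⊕ J') := by
  intro f ε hε
  obtain ⟨F, hF1, hF2, hF3⟩ := lemmaA (⟨fun x i => f x (Sum.inl i), by fun_prop⟩ : C(Y, Fin k → ℝ))
    ε hε
  obtain ⟨U, hU1, hU2⟩ := h F hF1 hF2
  obtain ⟨g, hg1, hg2⟩ := hF3 U hU1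
  obtain ⟨g', hg1', hg2'⟩ := hU2 ⟨fun x i => f x (Sum.inr i), by fun_prop⟩ ε hε
  refine ⟨⟨fun x => Sum.elim (g x) (g' x), ?_⟩, ?_, ?_⟩
  · refine continuous_pi fun j => ?_
    rcases j with j | j
    · simp only [Sum.elim_inl]; fun_prop
    · simp only [Sum.elim_inr]; fun_prop
  · intro x j
    rcases j with j | j
    · exact hg1 x j
    · exact hg1' x j
  · intro x _ h0
    have h1 : g x = 0 := by
      funext i
      exact congrFun h0 (Sum.inl i)
    apply hg2' x (hg2 x h1)
    funext i
    exact congrFun h0 (Sum.inr i)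

lemma unst_of_kIndLE {k : ℕ} (n : ℕ) : ∀ {Y : Type} [TopologicalSpace Y]
    [TopologicalSpace.MetrizableSpace Y], KIndLE (bComplex k) Y (n : Ordinal.{0}) →
    UnstOn (univ : Set Y) (Fin (n + 1) × Fin k) := by
  induction n with
  | zero =>
    intro Y _ _ h
    refine (combine (k := k) (J' := Fin 0) ?_).of_card_le (by simp)
    intro F h1 h2
    obtain ⟨U, hU, hU2⟩ := kIndLE_iff.mp h F h1 h2
    refine ⟨U, hU, ?_⟩
    rcases hU2 with h | ⟨β, hβ, -⟩
    · rw [h]; exact UnstOn.empty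
    · simp at hβ
  | succ n ih =>
    intro Y _ _ h
    refine (combine (k := k) (J' := Fin (n + 1) × Fin k) ?_).of_card_le (by
      simp only [Fintype.card_prod, Fintype.card_fin, Fintype.card_sum]
      ring_nf
      rfl)
    intro F h1 h2
    obtain ⟨U, hU, hU2⟩ := kIndLE_iff.mp h F h1 h2
    refine ⟨U, hU, ?_⟩
    rcases hU2 with h | ⟨β, hβ, hβ2⟩
    · rw [h]; exact UnstOn.empty
    · have hle : β ≤ (n : Ordinal.{0}) := by
        rw [Nat.cast_succ] at hβ
        exact Order.lt_add_one_iff.mp hβ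
      exact (ih (hβ2.mono hle)).of_subtype (isOpen_iUnion hU.1).isClosed_compl

lemma unst_of_kDimLE {k n : ℕ} {Y : Type} [TopologicalSpace Y]
    [TopologicalSpace.MetrizableSpace Y] (h : KDimLE (bComplex k) Y n) :
    UnstOn (univ : Set Y) (Fin (n + 1) × Fin k) := by
  intro f ε hε
  choose F hF1 hF2 hF3 using fun j : Fin (n + 1) =>
    lemmaA (⟨fun x i => f x (j, i), by fun_prop⟩ : C(Y, Fin k → ℝ)) ε hε
  obtain ⟨U, hU1, hU2⟩ := h F hF1 hF2
  choose g hg1 hg2 using fun j => hF3 j (U j) (hU1 j)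
  refine ⟨⟨fun x p => g p.1 x p.2, by fun_prop⟩, fun x p => hg1 p.1 x p.2, fun x _ h0 => ?_⟩
  have : x ∈ ⋂ j, (⋃ i, U j i)ᶜ := by
    rw [mem_iInter]
    intro j
    apply hg2
    funext i
    exact congrFun h0 (j, i)
  rw [hU2] at this
  exact this

lemma kDimLE_closedEmbedding {k n : ℕ} {Y Y' : Type} [TopologicalSpace Y]
    [TopologicalSpace Y'] {e : Y → Y'} (he : IsClosedEmbedding e) (h : KDimLE (bComplex k) Y' n) :
    KDimLE (bComplex k) Y n := by
  intro F h1 h2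
  obtain ⟨U, u1, u2⟩ := h (fun j i => e '' (F j i)) (fun j i => he.isClosedMap _ (h1 j i)) (by
    intro j
    have h3 := h2 j
    rw [isKTuple_iff] at h3 ⊢
    intro y
    by_cases hy : y ∈ range e
    · obtain ⟨x, rfl⟩ := hy
      obtain ⟨i, hi⟩ := h3 x
      refine ⟨i, ?_⟩
      rintro ⟨x', hx', hxx⟩
      exact hi (he.injective hxx ▸ hx')
    · exact ⟨0, fun ⟨x, _, hx⟩ => hy ⟨x, hx⟩⟩)
  refine ⟨fun j i => e ⁻¹' (U j i), fun j => ⟨fun i => ((u1 j).1 i).preimage he.continuous, ?_, ?_⟩, ?_⟩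
  · have := (u1 j).2.1
    rw [isKTuple_iff] at this ⊢
    exact fun x => this (e x)
  · intro i x hx
    exact (u1 j).2.2 i ⟨x, hx, rfl⟩
  · rw [eq_empty_iff_forall_notMem] at u2 ⊢
    intro x hx
    apply u2 (e x)
    simpa using hx

/-- Replacing an open cover of a closed set by disjoint open sets. -/
lemma disjointify {C : Type} [TopologicalSpace C] [CompactSpace C]
    [TopologicalSpace.MetrizableSpace C] {m e : ℕ} {P : Set C} (hP : IsClosed P)
    (h : UnstOn P (Fin (e + 1))) (O : Fin m → Set C) (hO : ∀ i, IsOpen (O i))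
    (hc : P ⊆ ⋃ i, O i) :
    ∃ O' : Fin m → Set C, (∀ i, IsOpen (O' i)) ∧ (∀ i, O' i ⊆ O i) ∧
      (∀ x i j, x ∈ O' i → x ∈ O' j → i = j) ∧ UnstOn (P \ ⋃ i, O' i) (Fin e) := by
  have : CompactSpace P := isCompact_iff_compactSpace.mp hP.isCompact
  obtain ⟨A, hA1, hA2, hA3⟩ := exists_subset_iUnion_closed_subset hP hO
    (fun x _ => Set.toFinite _) hc
  have hf : ∀ i, ∃ f : C(C, ℝ), (∀ x ∈ A i, 0 < f x) ∧ (∀ x, x ∉ O i → f x < 0) ∧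
      UnstOn {x | x ∈ P ∧ f x = 0} (Fin e) := by
    intro i
    obtain ⟨u, hu1, hu2, -⟩ := exists_continuous_zero_one_of_isClosed (hO i).isClosed_compl (hA2 i)
      (disjoint_left.mpr fun x hx hx' => hx (hA3 i hx'))
    obtain ⟨g, hg1, hg2⟩ := baire_real (h.subtype hP)
      (⟨fun x => 2 * u x - 1, by fun_prop⟩ : C(P, ℝ)) (1 / 2) (by norm_num)
    obtain ⟨w, hw1, hw2⟩ := ContinuousMap.exists_extension_forall_mem_of_isClosedEmbedding
      (⟨fun x => g x - (2 * u x - 1), by fun_prop⟩ : C(P, ℝ)) (t := Ioo (-(1 / 2)) (1 / 2))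
      (fun x => abs_lt.mp (hg1 x)) ⟨0, by norm_num⟩ hP.isClosedEmbedding_subtypeVal
    refine ⟨⟨fun x => (2 * u x - 1) + w x, by fun_prop⟩, fun x hx => ?_, fun x hx => ?_, ?_⟩
    · have h1 := hu2 hx
      have h2 := (hw1 x).1
      simp only [Pi.one_apply] at h1
      simp only [ContinuousMap.coe_mk, h1]
      linarith
    · have h1 := hu1 hx
      have h2 := (hw1 x).2
      simp only [Pi.zero_apply] at h1
      simp only [ContinuousMap.coe_mk, h1]
      linarith
    · refine (hg2.image hP.isClosedEmbedding_subtypeVal).mono ?_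
      rintro x ⟨hx, hx0⟩
      refine ⟨⟨x, hx⟩, ?_, rfl⟩
      have h3 := congrFun hw2 ⟨x, hx⟩
      simp only [Function.comp_apply, ContinuousMap.coe_mk] at h3 hx0
      simp only [mem_ofPred_eq]
      linarith
  choose f hf1 hf2 hf3 using hf
  refine ⟨fun i => {x | 0 < f i x} ∩ ⋂ l : Fin m, ⋂ _ : l < i, {x | f l x < 0}, fun i => ?_,
    fun i => ?_, ?_, ?_⟩
  · refine (isOpen_lt continuous_const (by fun_prop)).inter ?_
    refine isOpen_iInter_of_finite fun l => isOpen_iInter_of_finite fun _ =>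
      isOpen_lt (by fun_prop) continuous_const
  · rintro x ⟨hx, -⟩
    by_contra hcon
    exact lt_asymm hx (hf2 i x hcon)
  · intro x i j hi hj
    rcases lt_trichotomy i j with hlt | heq | hlt
    · have : f i x < 0 := mem_iInter₂.mp hj.2 i hlt
      have h0 : 0 < f i x := hi.1
      exact absurd h0 (lt_asymm this)
    · exact heq
    · have : f j x < 0 := mem_iInter₂.mp hi.2 j hlt
      have h0 : 0 < f j x := hj.1
      exact absurd h0 (lt_asymm this)
  · refine (UnstOn.biUnion Finset.univ (fun i => {x | x ∈ P ∧ f i x = 0}) (fun i _ => ?_)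
      (fun i _ => hf3 i)).mono ?_
    · exact (hP.inter (isClosed_eq (f i).continuous continuous_const)).isCompact
    · rintro x ⟨hx, hx2⟩
      by_contra hcon
      have hne : ∀ i, f i x ≠ 0 := by
        intro i h0
        exact hcon (by simpa using ⟨hx, i, h0⟩)
      obtain ⟨i0, hi0⟩ := mem_iUnion.mp (hA1 hx)
      obtain ⟨i, hi, hmin⟩ := WellFounded.has_min (wellFounded_lt (α := Fin m))
        {i | 0 < f i x} ⟨i0, hf1 i0 x hi0⟩
      apply hx2
      rw [mem_iUnion]
      refine ⟨i, hi, mem_iInter₂.mpr fun l hl => ?_⟩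
      exact lt_of_le_of_ne (not_lt.mp fun hp => hmin l hp hl) (hne l)

set_option linter.unusedSectionVars false

section ZInterface

variable {ι C : Type} [TopologicalSpace ι] [DiscreteTopology ι] [MetricSpace C] [CompactSpace C]
  {φ : ι → Set C}

lemma sfam_countable {S : Set C} (hS : S ∈ SFam C) : S.Countable := by
  rcases hS with h | ⟨⟨e⟩⟩
  · exact h.countable
  · have : Countable (OnePoint ℕ) := inferInstanceAs (Countable (Option ℕ))
    exact Set.countable_coe_iff.mp e.injective.countable

lemma sfam_compact {S : Set C} (hS : S ∈ SFam C) : IsCompact S := by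
  rcases hS with h | ⟨⟨e⟩⟩
  · exact h.isCompact
  · exact isCompact_iff_compactSpace.mpr e.symm.compactSpace


/-- The coordinate in the one-point compactification. -/
def za (z : ZSpace ι C C φ) : OnePoint ι :=
  Quot.lift (fun p : OnePoint ι × C × C => p.1) (fun _ _ h => h.1.trans h.2.1.symm) z.1

/-- The `y`-coordinate on `H(i)`, constant elsewhere. -/
def zy (c0 : C) (i : ι) (z : ZSpace ι C C φ) : C :=
  Quot.lift (fun p : OnePoint ι × C × C => if p.1 = (i : OnePoint ι) then p.2.2 else c0)
    (fun p q h => by simp [h.1, h.2.1]) z.1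

/-- The embedding of `H(μ)`. -/
def hmu (φ : ι → Set C) (x : C) : ZSpace ι C C φ :=
  ⟨Quot.mk _ (OnePoint.infty, x, x), (OnePoint.infty, x, x), rfl, Or.inl rfl⟩

/-- The embedding of `H(i)`. -/
def hal (φ : ι → Set C) (i : ι) (p : φ i × C) : ZSpace ι C C φ :=
  ⟨Quot.mk _ ((i : OnePoint ι), p.1.1, p.2), ((i : OnePoint ι), p.1.1, p.2), rfl,
    Or.inr ⟨i, rfl, p.1.2⟩⟩

lemma za_hmu (x : C) : za (hmu φ x) = OnePoint.infty := rfl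
lemma za_hal (i : ι) (p : φ i × C) : za (hal φ i p) = (i : OnePoint ι) := rfl
lemma zr_hmu (x : C) : ZProjX φ (hmu φ x) = x := rfl
lemma zr_hal (i : ι) (p : φ i × C) : ZProjX φ (hal φ i p) = p.1.1 := rfl
lemma zy_hal (c0 : C) (i : ι) (p : φ i × C) : zy c0 i (hal φ i p) = p.2 := by
  simp [zy, hal]

lemma z_cases (z : ZSpace ι C C φ) : (∃ x, z = hmu φ x) ∨ ∃ i p, z = hal φ i p := by
  obtain ⟨z, ⟨a, x, y⟩, rfl, h⟩ := z
  rcases h with h | ⟨i, h1, h2⟩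
  · left
    simp only at h
    subst h
    exact ⟨x, Subtype.ext (Quot.sound ⟨rfl, rfl, rfl⟩)⟩
  · right
    simp only at h1 h2
    subst h1
    exact ⟨i, ⟨⟨x, h2⟩, y⟩, rfl⟩

lemma z_eq_hmu {z : ZSpace ι C C φ} (h : za z = OnePoint.infty) : z = hmu φ (ZProjX φ z) := by
  rcases z_cases z with ⟨x, rfl⟩ | ⟨i, p, rfl⟩
  · rfl
  · exact absurd h (OnePoint.coe_ne_infty i)

lemma z_eq_hal {z : ZSpace ι C C φ} {i : ι} (h : za z = (i : OnePoint ι)) :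
    ∃ p, z = hal φ i p := by
  rcases z_cases z with ⟨x, rfl⟩ | ⟨j, p, rfl⟩
  · exact absurd h (OnePoint.infty_ne_coe i)
  · have : j = i := OnePoint.coe_injective h
    subst this
    exact ⟨p, rfl⟩

lemma continuous_za : Continuous (za : ZSpace ι C C φ → OnePoint ι) :=
  (continuous_quot_lift _ continuous_fst).comp continuous_subtype_val

lemma continuous_zr : Continuous (ZProjX φ : ZSpace ι C C φ → C) :=
  (continuous_quot_lift (f := fun p : OnePoint ι × C × C => p.2.1) _ (by fun_prop)).comp
    continuous_subtype_val

lemma isClopen_coe (i : ι) : IsClopen ({(i : OnePoint ι)} : Set (OnePoint ι)) := by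
  refine ⟨isClosed_singleton, ?_⟩
  have := OnePoint.isOpenEmbedding_coe.isOpenMap {i} (isOpen_discrete _)
  simpa using this

lemma continuous_zy (c0 : C) (i : ι) : Continuous (zy c0 i : ZSpace ι C C φ → C) := by
  refine (continuous_quot_lift
    (f := fun p : OnePoint ι × C × C => if p.1 = (i : OnePoint ι) then p.2.2 else c0) _ ?_).comp
    continuous_subtype_val
  refine continuous_if ?_ (by fun_prop) (by fun_prop)
  intro p hp
  exfalso
  have h1 : IsClopen {p : OnePoint ι × C × C | p.1 = (i : OnePoint ι)} :=
    (isClopen_coe i).preimage continuous_fst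
  rw [h1.frontier_eq] at hp
  exact hp

lemma continuous_hmu : Continuous (hmu φ) := by
  refine Continuous.subtype_mk ?_ _
  exact continuous_quot_mk.comp (by fun_prop)

lemma continuous_hal (i : ι) : Continuous (hal φ i) := by
  refine Continuous.subtype_mk ?_ _
  exact continuous_quot_mk.comp (by fun_prop)

lemma hmu_injective : Function.Injective (hmu φ) := fun x y h => by
  have := congrArg (ZProjX φ) h
  exact this

lemma hal_injective (i : ι) : Function.Injective (hal φ i) := fun p q h => by
  have h1 := congrArg (ZProjX φ) h
  have h2 := congrArg (zy p.2 i) h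
  rw [zy_hal, zy_hal] at h2
  exact Prod.ext (Subtype.ext h1) h2

instance z_t2 : T2Space (ZSpace ι C C φ) := by
  rcases isEmpty_or_nonempty (ZSpace ι C C φ) with h | ⟨⟨z0⟩⟩
  · infer_instance
  let c0 := ZProjX φ z0
  refine T2Space.of_injective_continuous
    (f := fun z => (za z, ZProjX φ z, fun i => zy c0 i z)) ?_ ?_
  · intro z z' h
    simp only [Prod.mk.injEq] at h
    obtain ⟨h1, h2, h3⟩ := h
    rcases z_cases z with ⟨x, rfl⟩ | ⟨i, p, rfl⟩
    · rw [z_eq_hmu h1.symm, ← h2]; rfl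
    · obtain ⟨q, rfl⟩ := z_eq_hal h1.symm
      have h4 := congrFun h3 i
      rw [zy_hal, zy_hal] at h4
      congr 1
      exact Prod.ext (Subtype.ext h2) h4
  · exact continuous_za.prodMk (continuous_zr.prodMk (continuous_pi fun i => continuous_zy c0 i))

lemma z_compact (hφ : ∀ i, φ i ∈ SFam C) : CompactSpace (ZSpace ι C C φ) := by
  let W : Set (OnePoint ι × C × C) :=
    {p | p.1 = OnePoint.infty ∨ ∃ i : ι, p.1 = (i : OnePoint ι) ∧ p.2.1 ∈ φ i}
  have hW : IsClosed W := by
    have e : Wᶜ = ⋃ i : ι, {p | p.1 = (i : OnePoint ι) ∧ p.2.1 ∉ φ i} := by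
      ext ⟨a, x, y⟩
      simp only [W, mem_compl_iff, mem_ofPred_eq, mem_iUnion, not_or, not_exists, not_and]
      constructor
      · rintro ⟨h1, h2⟩
        obtain ⟨i, rfl⟩ := OnePoint.ne_infty_iff_exists.mp h1
        exact ⟨i, rfl, h2 i rfl⟩
      · rintro ⟨i, rfl, h⟩
        refine ⟨OnePoint.coe_ne_infty i, fun j hj => ?_⟩
        have : i = j := OnePoint.coe_injective hj
        exact this ▸ h
    rw [← isOpen_compl_iff, e]
    refine isOpen_iUnion fun i => ?_
    exact ((isClopen_coe i).2.preimage continuous_fst).inter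
      ((sfam_compact (hφ i)).isClosed.isOpen_compl.preimage (continuous_fst.comp continuous_snd))
  have : CompactSpace W := isCompact_iff_compactSpace.mp hW.isCompact
  let q : W → ZSpace ι C C φ := fun p => ⟨Quot.mk _ p.1, p.1, rfl, p.2⟩
  have hq : Continuous q := Continuous.subtype_mk (continuous_quot_mk.comp continuous_subtype_val) _
  refine Function.Surjective.compactSpace hq (f := q) ?_
  rintro ⟨z, p, rfl, h⟩
  exact ⟨⟨p, h⟩, rfl⟩

lemma hmu_closedEmbedding : IsClosedEmbedding (hmu φ) :=
  continuous_hmu.isClosedEmbedding hmu_injective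

lemma hal_range (i : ι) : range (hal φ i) = za ⁻¹' {(i : OnePoint ι)} := by
  ext z
  constructor
  · rintro ⟨p, rfl⟩; rfl
  · intro h
    obtain ⟨p, rfl⟩ := z_eq_hal h
    exact ⟨p, rfl⟩

lemma isClopen_za (i : ι) : IsClopen {z : ZSpace ι C C φ | za z = (i : OnePoint ι)} :=
  (isClopen_coe i).preimage continuous_za

lemma hal_closedEmbedding (hφ : ∀ i, φ i ∈ SFam C) (i : ι) : IsClosedEmbedding (hal φ i) := by
  have : CompactSpace (φ i) := isCompact_iff_compactSpace.mp (sfam_compact (hφ i))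
  exact (continuous_hal i).isClosedEmbedding (hal_injective i)

lemma hal_openEmbedding (hφ : ∀ i, φ i ∈ SFam C) (i : ι) : IsOpenEmbedding (hal φ i) :=
  ⟨(hal_closedEmbedding hφ i).isEmbedding, by rw [hal_range]; exact (isClopen_za i).2⟩

/-- Closed sets missing `H(μ)` meet only finitely many `H(i)`. -/
lemma finite_of_closed (hφ : ∀ i, φ i ∈ SFam C) {S : Set (ZSpace ι C C φ)} (hS : IsClosed S)
    (h : ∀ x, hmu φ x ∉ S) : ∃ A : Finset ι, ∀ z ∈ S, ∃ i ∈ A, za z = (i : OnePoint ι) := by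
  have := z_compact hφ
  obtain ⟨A, hA⟩ := hS.isCompact.elim_finite_subcover
    (fun i : ι => {z : ZSpace ι C C φ | za z = (i : OnePoint ι)}) (fun i => (isClopen_za i).2) (by
      intro z hz
      rcases z_cases z with ⟨x, rfl⟩ | ⟨i, p, rfl⟩
      · exact absurd hz (h x)
      · exact mem_iUnion.mpr ⟨i, rfl⟩)
  refine ⟨A, fun z hz => ?_⟩
  simpa using hA hz

lemma isClopen_avoid (A : Finset ι) :
    IsClopen {z : ZSpace ι C C φ | ∀ i ∈ A, za z ≠ (i : OnePoint ι)} := by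
  have e : {z : ZSpace ι C C φ | ∀ i ∈ A, za z ≠ (i : OnePoint ι)} =
      ⋂ i ∈ A, {z : ZSpace ι C C φ | za z = (i : OnePoint ι)}ᶜ := by
    ext z; simp
  rw [e]
  exact isClopen_biInter_finset fun i _ => (isClopen_za i).compl

lemma z_tube (hφ : ∀ i, φ i ∈ SFam C) {O : Set (ZSpace ι C C φ)} (hO : IsOpen O) {x : C}
    (hx : hmu φ x ∈ O) : ∃ A : Finset ι, ∃ V ∈ 𝓝 x, ∀ z : ZSpace ι C C φ,
      (∀ i ∈ A, za z ≠ (i : OnePoint ι)) → ZProjX φ z ∈ V → z ∈ O := by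
  obtain ⟨V, hV1, hV2, hV3⟩ := exists_mem_nhds_isClosed_subset
    ((hO.preimage continuous_hmu).mem_nhds hx)
  obtain ⟨A, hA⟩ := finite_of_closed hφ (S := Oᶜ ∩ ZProjX φ ⁻¹' V)
    (hO.isClosed_compl.inter (hV2.preimage continuous_zr)) (fun y hy => hy.1 (hV3 hy.2))
  refine ⟨A, V, hV1, fun z h1 h2 => ?_⟩
  by_contra hcon
  obtain ⟨i, hi, hi2⟩ := hA z ⟨hcon, h2⟩
  exact h1 i hi hi2

/-- A real valued comparison. -/
lemma z_close (hφ : ∀ i, φ i ∈ SFam C) {E : Type} [SeminormedAddCommGroup E]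
    (f : C(ZSpace ι C C φ, E)) {ε : ℝ} (hε : 0 < ε) :
    ∃ A : Finset ι, ∀ z, (∀ i ∈ A, za z ≠ (i : OnePoint ι)) →
      ‖f z - f (hmu φ (ZProjX φ z))‖ < ε := by
  obtain ⟨A, hA⟩ := finite_of_closed hφ (S := {z | ε ≤ ‖f z - f (hmu φ (ZProjX φ z))‖})
    (isClosed_le continuous_const
      ((f.continuous.sub (f.continuous.comp (continuous_hmu.comp continuous_zr))).norm))
    (fun x hx => by
      have : ε ≤ ‖f (hmu φ x) - f (hmu φ x)‖ := hx
      rw [sub_self, norm_zero] at this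
      linarith)
  refine ⟨A, fun z h => ?_⟩
  by_contra hcon
  push Not at hcon
  obtain ⟨i, hi, hi2⟩ := hA z hcon
  exact h i hi hi2

open Filter in
lemma z_frechet (hφ : ∀ i, φ i ∈ SFam C) : FrechetUrysohnSpace (ZSpace ι C C φ) := by
  refine ⟨fun s z hz => ?_⟩
  rcases z_cases z with ⟨x, rfl⟩ | ⟨i, p, rfl⟩
  · by_cases hmx : hmu φ x ∈ closure (s ∩ range (hmu φ) : Set (ZSpace ι C C φ))
    · have h1 : x ∈ closure (hmu φ ⁻¹' s) := by
        rw [(hmu_closedEmbedding (φ := φ)).isEmbedding.closure_eq_preimage_closure_image,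
          image_preimage_eq_inter_range]
        exact hmx
      obtain ⟨u, hu1, hu2⟩ := mem_closure_iff_seq_limit.mp h1
      exact ⟨fun n => hmu φ (u n), hu1, (continuous_hmu.tendsto x).comp hu2⟩
    · have key : ∀ (A : Finset ι) (n : ℕ), ∃ i : ι, i ∉ A ∧ ∃ z ∈ s, za z = (i : OnePoint ι) ∧
          dist (ZProjX φ z) x < 1 / ((n : ℝ) + 1) := by
        intro A n
        have hO : IsOpen ((closure (s ∩ range (hmu φ)))ᶜ ∩
            ({z : ZSpace ι C C φ | ∀ i ∈ A, za z ≠ (i : OnePoint ι)} ∩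
            ZProjX φ ⁻¹' (Metric.ball x (1 / ((n : ℝ) + 1))))) :=
          isClosed_closure.isOpen_compl.inter ((isClopen_avoid A).2.inter
            (Metric.isOpen_ball.preimage continuous_zr))
        obtain ⟨z, ⟨hz1, hz2, hz3⟩, hzs⟩ := mem_closure_iff.mp hz _ hO
          ⟨hmx, fun i _ => OnePoint.infty_ne_coe i, Metric.mem_ball_self (by positivity)⟩
        rcases z_cases z with ⟨y, rfl⟩ | ⟨i, p, rfl⟩
        · exact absurd (subset_closure (show hmu φ y ∈ s ∩ range (hmu φ) from ⟨hzs, y, rfl⟩)) hz1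
        · exact ⟨i, fun hi => hz2 i hi rfl, _, hzs, rfl, hz3⟩
      choose I hI1 w hw1 hw2 hw3 using key
      let T : ℕ → Finset ι := fun n => Nat.rec ∅ (fun m A => insert (I A m) A) n
      have hT : ∀ n, T (n + 1) = insert (I (T n) n) (T n) := fun n => rfl
      have hmono : Monotone T := monotone_nat_of_le_succ fun n => by
        rw [hT]; exact Finset.subset_insert _ _
      have hinj : Function.Injective (fun n => I (T n) n) := by
        have hlt : ∀ m n, m < n → I (T m) m ≠ I (T n) n := ?_
        · intro m n hmn
          by_contra hne
          rcases lt_or_gt_of_ne hne with hl | hl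
          · exact hlt m n hl hmn
          · exact hlt n m hl hmn.symm
        intro m n hmn heq
        apply hI1 (T n) n
        rw [← heq]
        apply hmono (Nat.succ_le_of_lt hmn)
        rw [hT]
        exact Finset.mem_insert_self _ _
      refine ⟨fun n => w (T n) n, fun n => hw1 _ _, ?_⟩
      rw [tendsto_nhds]
      intro O hO hxO
      obtain ⟨A, V, hV, hAV⟩ := z_tube hφ hO hxO
      have h1 : Tendsto (fun n => ZProjX φ (w (T n) n)) atTop (𝓝 x) := by
        rw [tendsto_iff_dist_tendsto_zero]
        exact squeeze_zero (fun _ => dist_nonneg) (fun n => (hw3 _ n).le)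
          tendsto_one_div_add_atTop_nhds_zero_nat
      have h2 : ∀ᶠ n in atTop, I (T n) n ∉ A := by
        rw [← Nat.cofinite_eq_atTop]
        have : ((fun n => I (T n) n) ⁻¹' (A : Set ι)).Finite :=
          A.finite_toSet.preimage hinj.injOn
        exact this.compl_mem_cofinite
      filter_upwards [h1 hV, h2] with n hn1 hn2
      refine hAV _ (fun i hi hi2 => ?_) hn1
      rw [hw2] at hi2
      exact hn2 (OnePoint.coe_injective hi2 ▸ hi)
  · have h1 : p ∈ closure (hal φ i ⁻¹' s) := by
      rw [← (hal_openEmbedding hφ i).isOpenMap.preimage_closure_eq_closure_preimage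
        (continuous_hal i)]
      exact hz
    obtain ⟨u, hu1, hu2⟩ := mem_closure_iff_seq_limit.mp h1
    exact ⟨fun n => hal φ i (u n), hu1, ((continuous_hal i).tendsto p).comp hu2⟩

/-- Components of the space `Z`. -/
lemma z_component [ConnectedSpace C] (hφ : ∀ i, φ i ∈ SFam C) (z : ZSpace ι C C φ) :
    Nonempty (↥(connectedComponent z) ≃ₜ C) := by
  rcases z_cases z with ⟨x, rfl⟩ | ⟨i, p, rfl⟩
  · have e : connectedComponent (hmu φ x) = range (hmu φ) := by
      apply Subset.antisymm
      · intro w hw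
        rcases z_cases w with ⟨y, rfl⟩ | ⟨j, q, rfl⟩
        · exact ⟨y, rfl⟩
        · exfalso
          have h1 := (isClopen_za (φ := φ) j).compl.connectedComponent_subset
            (x := hmu φ x) (OnePoint.infty_ne_coe j)
          exact h1 hw rfl
      · exact (isPreconnected_range continuous_hmu).subset_connectedComponent ⟨x, rfl⟩
    rw [e]
    exact ⟨hmu_closedEmbedding.isEmbedding.toHomeomorph.symm⟩
  · have : Countable (φ i) := Set.countable_coe_iff.mpr (sfam_countable (hφ i))
    have hc : Continuous (fun y : C => hal φ i (p.1, y)) := (continuous_hal i).comp (by fun_prop)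
    have hinj : Function.Injective (fun y : C => hal φ i (p.1, y)) := fun y y' h =>
      congrArg Prod.snd (hal_injective i h)
    have e : connectedComponent (hal φ i p) = range (fun y : C => hal φ i (p.1, y)) := by
      apply Subset.antisymm
      · intro w hw
        have h1 := (isClopen_za (φ := φ) i).connectedComponent_subset (x := hal φ i p) rfl
        obtain ⟨q, rfl⟩ := z_eq_hal (h1 hw)
        have h2 : IsPreconnected (hal φ i ⁻¹' (connectedComponent (hal φ i p))) :=
          isPreconnected_connectedComponent.preimage_of_isOpenMap (hal_injective i)
            (hal_openEmbedding hφ i).isOpenMap (by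
              rw [hal_range]; exact h1)
        have h3 := (h2.image Prod.fst continuous_fst.continuousOn).subsingleton
          ⟨q, hw, rfl⟩ ⟨p, mem_connectedComponent, rfl⟩
        exact ⟨q.2, by simp only [← h3]⟩
      · exact (isPreconnected_range hc).subset_connectedComponent ⟨p.2, rfl⟩
    rw [e]
    exact ⟨(hc.isClosedEmbedding hinj).isEmbedding.toHomeomorph.symm⟩

/-- Products with zero-dimensional compacta do not increase the dimension. -/
lemma unst_prod {S : Type} [TopologicalSpace S] [CompactSpace S] [T2Space S]
    [TotallyDisconnectedSpace S] {J : Type} [Fintype J] (h : UnstOn (univ : Set C) J) :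
    UnstOn (univ : Set (S × C)) J := by
  intro f ε hε
  have key : ∃ T' : Set S, IsClopen T' ∧ Set.univ ⊆ T' ∧ ∃ g : C(S × C, J → ℝ),
      (∀ x j, |g x j - f x j| < ε) ∧ ∀ x, x.1 ∈ T' → g x ≠ 0 := by
    refine isCompact_univ.induction_on (p := fun T => ∃ T' : Set S, IsClopen T' ∧ T ⊆ T' ∧
      ∃ g : C(S × C, J → ℝ), (∀ x j, |g x j - f x j| < ε) ∧ ∀ x, x.1 ∈ T' → g x ≠ 0) ?_ ?_ ?_ ?_
    · exact ⟨∅, isClopen_empty, Subset.rfl, f, by simp [hε], by simp⟩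
    · rintro s t hst ⟨T', h1, h2, h3⟩
      exact ⟨T', h1, hst.trans h2, h3⟩
    · rintro s t ⟨T1, a1, a2, g1, a3, a4⟩ ⟨T2, b1, b2, g2, b3, b4⟩
      refine ⟨T1 ∪ T2, a1.union b1, union_subset_union a2 b2,
        ⟨fun x => if x.1 ∈ T1 then g1 x else g2 x, ?_⟩, ?_, ?_⟩
      · refine continuous_if ?_ (by fun_prop) (by fun_prop)
        intro p hp
        exfalso
        have h1 : IsClopen {p : S × C | p.1 ∈ T1} := a1.preimage continuous_fst
        rw [h1.frontier_eq] at hp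
        exact hp
      · intro x j
        by_cases hx : x.1 ∈ T1
        · simpa [hx] using a3 x j
        · simpa [hx] using b3 x j
      · intro x hx
        by_cases hx1 : x.1 ∈ T1
        · simpa [hx1] using a4 x hx1
        · simpa [hx1] using b4 x (hx.resolve_left hx1)
    · intro s _
      obtain ⟨g, hg1, hg2⟩ := h (f.curry s) (ε / 2) (by positivity)
      obtain ⟨G, hG1, hG2, hG3⟩ := compact_exists_isClopen_in_isOpen
        (Metric.isOpen_ball.preimage f.curry.continuous : IsOpen (f.curry ⁻¹' Metric.ball (f.curry s) (ε / 2)))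
        (Metric.mem_ball_self (by positivity) : f.curry s ∈ Metric.ball (f.curry s) (ε / 2))
      refine ⟨G, mem_nhdsWithin_of_mem_nhds (hG1.2.mem_nhds hG2), G, hG1, Subset.rfl,
        ⟨fun x => if x.1 ∈ G then g x.2 else f x, ?_⟩, ?_, ?_⟩
      · refine continuous_if ?_ (by fun_prop) (by fun_prop)
        intro p hp
        exfalso
        have h1 : IsClopen {p : S × C | p.1 ∈ G} := hG1.preimage continuous_fst
        rw [h1.frontier_eq] at hp
        exact hp
      · intro x j
        by_cases hx : x.1 ∈ G
        · simp only [ContinuousMap.coe_mk, hx, if_true]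
          have h1 := hg1 x.2 j
          have h2 : dist (f.curry x.1) (f.curry s) < ε / 2 := hG3 hx
          have h3 : dist (f.curry x.1 x.2 j) (f.curry s x.2 j) < ε / 2 :=
            lt_of_le_of_lt ((dist_le_pi_dist _ _ j).trans (ContinuousMap.dist_apply_le_dist x.2)) h2
          rw [Real.dist_eq] at h3
          simp only [ContinuousMap.curry_apply] at h1 h3
          rw [abs_lt] at h1 h3 ⊢
          constructor <;> linarith
        · simpa [hx] using hε
      · intro x hx
        simpa [hx] using hg2 x.2 trivial
  obtain ⟨T', -, h2, g, h3, h4⟩ := key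
  exact ⟨g, h3, fun x _ => h4 x (h2 trivial)⟩

/-- The covering dimension of `Z` is at most that of `C`. -/
lemma unst_z (hφ : ∀ i, φ i ∈ SFam C) {J : Type} [Fintype J] (h : UnstOn (univ : Set C) J) :
    UnstOn (univ : Set (ZSpace ι C C φ)) J := by
  have := z_compact hφ
  intro f ε hε
  obtain ⟨A, hA⟩ := z_close hφ f (show 0 < ε / 2 by positivity)
  have hHA : UnstOn (⋃ i ∈ A, {z : ZSpace ι C C φ | za z = (i : OnePoint ι)}) J := by
    refine UnstOn.biUnion A _ (fun i _ => (isClopen_za i).1.isCompact) fun i _ => ?_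
    have : Countable (φ i) := Set.countable_coe_iff.mpr (sfam_countable (hφ i))
    have : CompactSpace (φ i) := isCompact_iff_compactSpace.mp (sfam_compact (hφ i))
    refine ((unst_prod (S := φ i) h).image (hal_closedEmbedding hφ i)).mono ?_
    rw [image_univ, hal_range]
    exact Subset.rfl
  obtain ⟨g1, a1, a2⟩ := hHA f ε hε
  obtain ⟨g2, b1, b2⟩ := h (f.comp ⟨hmu φ, continuous_hmu⟩) (ε / 2) (by positivity)
  refine ⟨⟨fun z => if ∀ i ∈ A, za z ≠ (i : OnePoint ι) then g2 (ZProjX φ z) else g1 z, ?_⟩, ?_, ?_⟩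
  · refine continuous_if ?_ (g2.continuous.comp continuous_zr).continuousOn (by fun_prop)
    intro p hp
    exfalso
    rw [(isClopen_avoid A).frontier_eq] at hp
    exact hp
  · intro z j
    by_cases hz : ∀ i ∈ A, za z ≠ (i : OnePoint ι)
    · simp only [ContinuousMap.coe_mk, if_pos hz]
      have h1 := b1 (ZProjX φ z) j
      have h2 := lt_of_le_of_lt (norm_le_pi_norm _ j) (hA z hz)
      rw [Real.norm_eq_abs, Pi.sub_apply] at h2
      simp only [ContinuousMap.comp_apply, ContinuousMap.coe_mk] at h1
      rw [abs_lt] at h1 h2 ⊢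
      constructor <;> linarith
    · simp only [ContinuousMap.coe_mk, if_neg hz]
      exact a1 z j
  · intro z _
    by_cases hz : ∀ i ∈ A, za z ≠ (i : OnePoint ι)
    · simp only [ContinuousMap.coe_mk, if_pos hz]
      exact b2 _ trivial
    · simp only [ContinuousMap.coe_mk, if_neg hz]
      apply a2
      push Not at hz
      obtain ⟨i, hi, hi2⟩ := hz
      exact mem_iUnion₂.mpr ⟨i, hi, hi2⟩

end ZInterface

section ZUpper

variable {ι C : Type} [TopologicalSpace ι] [DiscreteTopology ι] [MetricSpace C] [CompactSpace C]
  {φ : ι → Set C}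

/-- The main construction for the upper bounds. -/
lemma z_construct (hφ : ∀ i, φ i ∈ SFam C) {E : Type} [NormedAddCommGroup E]
    (f : C(ZSpace ι C C φ, E)) (c : E) (hc : c ≠ 0) :
    ∃ (A : Finset ι) (U : Set (ZSpace ι C C φ)) (g : ZSpace ι C C φ → E), IsOpen U ∧
      ContinuousOn g U ∧ (∀ z ∈ U, g z ≠ 0) ∧ (∀ z, 1 ≤ ‖f z‖ → z ∈ U ∧ g z = f z) ∧
      (∀ z ∈ Uᶜ, za z = OnePoint.infty ∨ ∃ i ∈ A, za z = (i : OnePoint ι)) ∧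
      ∀ w ∈ U, (g w = f w ∧ 1 / 4 ≤ ‖f w‖) ∨ g w = c := by
  obtain ⟨A, hA⟩ := z_close hφ f (show (0 : ℝ) < 1 / 4 by norm_num)
  let m : C → ℝ := fun x => ‖f (hmu φ x)‖
  have hm : Continuous m := (f.continuous.comp continuous_hmu).norm
  have hmr : Continuous fun z : ZSpace ι C C φ => m (ZProjX φ z) := hm.comp continuous_zr
  have ht : ∀ i, ∃ t : ℝ, 1 / 2 < t ∧ t < 3 / 4 ∧ ∀ x ∈ φ i, m x ≠ t := by
    intro i
    have h1 : (m '' (φ i)).Countable := (sfam_countable (hφ i)).image m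
    have h2 : ¬ (Ioo (1 / 2 : ℝ) (3 / 4)).Countable := by
      intro hcon
      have h3 := hcon.le_aleph0
      rw [Cardinal.mk_Ioo_real (by norm_num)] at h3
      exact absurd h3 (not_le.mpr Cardinal.aleph0_lt_continuum)
    obtain ⟨t, ht1, ht2⟩ : ∃ t ∈ Ioo (1 / 2 : ℝ) (3 / 4), t ∉ m '' (φ i) := by
      by_contra hcon
      push Not at hcon
      exact h2 (h1.mono hcon)
    exact ⟨t, ht1.1, ht1.2, fun x hx he => ht2 ⟨x, hx, he⟩⟩
  choose t ht1 ht2 ht3 using ht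
  let U : Set (ZSpace ι C C φ) := {z | (za z = OnePoint.infty ∧ 3 / 4 < ‖f z‖) ∨
    (∃ i ∈ A, za z = (i : OnePoint ι) ∧ 1 / 2 < ‖f z‖) ∨ ∃ i ∉ A, za z = (i : OnePoint ι)}
  let Q : ZSpace ι C C φ → Prop := fun z => ∃ i ∉ A, za z = (i : OnePoint ι) ∧ m (ZProjX φ z) < t i
  let g : ZSpace ι C C φ → E := fun z => if Q z then c else f z
  have hA' : ∀ z (i : ι), i ∉ A → za z = (i : OnePoint ι) →
      |‖f z‖ - m (ZProjX φ z)| < 1 / 4 := by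
    intro z i hi hz
    refine lt_of_le_of_lt (abs_norm_sub_norm_le _ _) (hA z fun j hj hj2 => ?_)
    rw [hz] at hj2
    exact hi (OnePoint.coe_injective hj2 ▸ hj)
  have hfm : ∀ x, ‖f (hmu φ x)‖ = m x := fun x => rfl
  have key : ∀ z ∈ U, ∃ N : Set (ZSpace ι C C φ), IsOpen N ∧ z ∈ N ∧ N ⊆ U ∧
      ((∀ w ∈ N, g w = f w) ∨ ∀ w ∈ N, g w = c) := by
    intro z hz
    rcases z_cases z with ⟨x, rfl⟩ | ⟨i, p, rfl⟩
    · have hx : 3 / 4 < m x := by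
        rcases hz with hz | ⟨i, -, hz, -⟩ | ⟨i, -, hz⟩
        · exact hz.2
        · exact absurd hz (OnePoint.infty_ne_coe i)
        · exact absurd hz (OnePoint.infty_ne_coe i)
      refine ⟨{w | ∀ i ∈ A, za w ≠ (i : OnePoint ι)} ∩ {w | 3 / 4 < m (ZProjX φ w)},
        (isClopen_avoid A).2.inter (isOpen_lt continuous_const hmr),
        ⟨fun i _ => OnePoint.infty_ne_coe i, hx⟩, ?_, Or.inl ?_⟩
      · rintro w ⟨hw1, hw2⟩
        rcases z_cases w with ⟨y, rfl⟩ | ⟨j, q, rfl⟩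
        · exact Or.inl ⟨rfl, hw2⟩
        · exact Or.inr (Or.inr ⟨j, fun hj => hw1 j hj rfl, rfl⟩)
      · rintro w ⟨hw1, hw2⟩
        refine if_neg ?_
        rintro ⟨j, -, -, hj⟩
        have := ht2 j
        have hw3 : 3 / 4 < m (ZProjX φ w) := hw2
        linarith
    · by_cases hi : i ∈ A
      · have hx : 1 / 2 < ‖f (hal φ i p)‖ := by
          rcases hz with hz | ⟨j, -, hz, hz2⟩ | ⟨j, hj, hz⟩
          · exact absurd hz.1 (OnePoint.coe_ne_infty i)
          · exact hz2
          · have : i = j := OnePoint.coe_injective hz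
            exact absurd (this ▸ hi) hj
        refine ⟨{w | za w = (i : OnePoint ι)} ∩ {w | 1 / 2 < ‖f w‖},
          (isClopen_za i).2.inter (isOpen_lt continuous_const f.continuous.norm), ⟨rfl, hx⟩, ?_,
          Or.inl ?_⟩
        · rintro w ⟨hw1, hw2⟩
          exact Or.inr (Or.inl ⟨i, hi, hw1, hw2⟩)
        · rintro w ⟨hw1, hw2⟩
          refine if_neg ?_
          rintro ⟨j, hj, hj2, -⟩
          have : i = j := OnePoint.coe_injective (hw1.symm.trans hj2)
          exact hj (this ▸ hi)
      · have hne : m (ZProjX φ (hal φ i p)) ≠ t i := ht3 i _ p.1.2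
        rcases lt_or_gt_of_ne hne with hlt | hgt
        · refine ⟨{w | za w = (i : OnePoint ι)} ∩ {w | m (ZProjX φ w) < t i},
            (isClopen_za i).2.inter (isOpen_lt hmr continuous_const), ⟨rfl, hlt⟩, ?_, Or.inr ?_⟩
          · rintro w ⟨hw1, hw2⟩
            exact Or.inr (Or.inr ⟨i, hi, hw1⟩)
          · rintro w ⟨hw1, hw2⟩
            exact if_pos ⟨i, hi, hw1, hw2⟩
        · refine ⟨{w | za w = (i : OnePoint ι)} ∩ {w | t i < m (ZProjX φ w)},
            (isClopen_za i).2.inter (isOpen_lt continuous_const hmr), ⟨rfl, hgt⟩, ?_, Or.inl ?_⟩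
          · rintro w ⟨hw1, hw2⟩
            exact Or.inr (Or.inr ⟨i, hi, hw1⟩)
          · rintro w ⟨hw1, hw2⟩
            refine if_neg ?_
            rintro ⟨j, hj, hj2, hj3⟩
            have : i = j := OnePoint.coe_injective (hw1.symm.trans hj2)
            subst this
            exact lt_asymm hj3 hw2
  have last : ∀ w ∈ U, (g w = f w ∧ 1 / 4 ≤ ‖f w‖) ∨ g w = c := by
    intro w hw
    by_cases hQ : Q w
    · exact Or.inr (if_pos hQ)
    · refine Or.inl ⟨if_neg hQ, ?_⟩
      rcases hw with hz | ⟨j, -, hz, hz2⟩ | ⟨j, hj, hz⟩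
      · linarith [hz.2]
      · linarith
      · have h1 : t j ≤ m (ZProjX φ w) := by
          by_contra hcon
          exact hQ ⟨j, hj, hz, not_le.mp hcon⟩
        have h2 := hA' w j hj hz
        have := ht1 j
        rw [abs_lt] at h2
        linarith [h2.1]
  refine ⟨A, U, g, ?_, ?_, ?_, ?_, ?_, last⟩
  · rw [isOpen_iff_forall_mem_open]
    intro z hz
    obtain ⟨N, h1, h2, h3, -⟩ := key z hz
    exact ⟨N, h3, h1, h2⟩
  · intro z hz
    obtain ⟨N, h1, h2, h3, h4⟩ := key z hz
    apply ContinuousAt.continuousWithinAt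
    rcases h4 with h4 | h4
    · exact f.continuous.continuousAt.congr
        (Filter.mem_of_superset (h1.mem_nhds h2) fun w hw => (h4 w hw).symm)
    · exact (continuousAt_const (y := c)).congr
        (Filter.mem_of_superset (h1.mem_nhds h2) fun w hw => (h4 w hw).symm)
  · intro z hz h0
    rcases last z hz with ⟨h1, h2⟩ | h1
    · rw [← h1, h0, norm_zero] at h2
      norm_num at h2
    · exact hc (h1.symm.trans h0)
  · intro z hz
    rcases z_cases z with ⟨x, rfl⟩ | ⟨i, p, rfl⟩
    · refine ⟨Or.inl ⟨rfl, by linarith⟩, if_neg ?_⟩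
      rintro ⟨j, -, hj, -⟩
      exact absurd hj (OnePoint.infty_ne_coe j)
    · by_cases hi : i ∈ A
      · refine ⟨Or.inr (Or.inl ⟨i, hi, rfl, by linarith⟩), if_neg ?_⟩
        rintro ⟨j, hj, hj2, -⟩
        have : i = j := OnePoint.coe_injective hj2
        exact hj (this ▸ hi)
      · refine ⟨Or.inr (Or.inr ⟨i, hi, rfl⟩), if_neg ?_⟩
        rintro ⟨j, hj, hj2, hj3⟩
        have h2 := hA' _ j hj hj2
        have := ht2 j
        rw [abs_lt] at h2
        linarith [h2.2]
  · intro z hz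
    rcases z_cases z with ⟨x, rfl⟩ | ⟨i, p, rfl⟩
    · exact Or.inl rfl
    · by_cases hi : i ∈ A
      · exact Or.inr ⟨i, hi, rfl⟩
      · exact absurd (Or.inr (Or.inr ⟨i, hi, rfl⟩)) hz

lemma z_metrizable [Nonempty C] (hφ : ∀ i, φ i ∈ SFam C) {P : Set (ZSpace ι C C φ)}
    (hP : IsClosed P) (A : Finset ι)
    (h : ∀ z ∈ P, za z = OnePoint.infty ∨ ∃ i ∈ A, za z = (i : OnePoint ι)) :
    TopologicalSpace.MetrizableSpace P := by
  have := z_compact hφ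
  have : CompactSpace P := isCompact_iff_compactSpace.mp hP.isCompact
  let c0 : C := Classical.arbitrary C
  let G : P → C × (A → C) × (A → Bool) := fun z =>
    (ZProjX φ z.1, fun i => zy c0 i.1 z.1, fun i => decide (za z.1 = ((i.1 : ι) : OnePoint ι)))
  have hG : Continuous G := by
    refine (continuous_zr.comp continuous_subtype_val).prodMk (Continuous.prodMk ?_ ?_)
    · exact continuous_pi fun i => (continuous_zy c0 i.1).comp continuous_subtype_val
    · refine continuous_pi fun i => ?_
      have hb : Continuous fun a : OnePoint ι => decide (a = ((i.1 : ι) : OnePoint ι)) := by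
        rw [continuous_bool_rng true]
        have e : (fun a : OnePoint ι => decide (a = ((i.1 : ι) : OnePoint ι))) ⁻¹' {true} =
            {((i.1 : ι) : OnePoint ι)} := by
          ext a; simp
        rw [e]
        exact isClopen_coe i.1
      exact hb.comp (continuous_za.comp continuous_subtype_val)
  have hinj : Function.Injective G := by
    rintro ⟨z, hz⟩ ⟨w, hw⟩ he
    simp only [G, Prod.mk.injEq] at he
    obtain ⟨h1, h2, h3⟩ := he
    apply Subtype.ext
    have h3' : ∀ i ∈ A, (za z = (i : OnePoint ι) ↔ za w = (i : OnePoint ι)) := by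
      intro i hi
      have := congrFun h3 ⟨i, hi⟩
      simpa using this
    simp only
    rcases h z hz with hz1 | ⟨i, hi, hz1⟩
    · rcases h w hw with hw1 | ⟨j, hj, hw1⟩
      · rw [z_eq_hmu hz1, z_eq_hmu hw1, h1]
      · have := (h3' j hj).mpr hw1
        rw [hz1] at this
        exact absurd this (OnePoint.infty_ne_coe j)
    · have hw1 := (h3' i hi).mp hz1
      obtain ⟨p, rfl⟩ := z_eq_hal hz1
      obtain ⟨q, rfl⟩ := z_eq_hal hw1
      have h4 := congrFun h2 ⟨i, hi⟩
      simp only [zy_hal] at h4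
      congr 1
      exact Prod.ext (Subtype.ext h1) h4
  exact (hG.isClosedEmbedding hinj).isEmbedding.metrizableSpace

lemma toSph_scale {k : ℕ} (s : Sph k) (v : Fin k → ℝ) (hv : v ≠ 0) (c : ℝ) (hc : 0 < c)
    (h : ∀ i, v i = c * s.1 i) : toSph v hv = s := by
  have e : (WithLp.toLp 2 v : EuclideanSpace ℝ (Fin k)) = c • s.1 := by
    ext i
    exact h i
  apply Subtype.ext
  simp only [toSph]
  have hs := s.2
  rw [mem_sphere_zero_iff_norm] at hs
  rw [e, norm_smul, hs, Real.norm_eq_abs, abs_of_pos hc, mul_one, smul_smul,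
    inv_mul_cancel₀ hc.ne', one_smul]

lemma z_lIndLE_part [Nonempty C] (hφ : ∀ i, φ i ∈ SFam C) {k n : ℕ}
    (h : UnstOn (univ : Set C) (Fin (n + 1) × Fin k)) {P : Set (ZSpace ι C C φ)}
    (hP : IsClosed P) (A : Finset ι)
    (hPA : ∀ z ∈ P, za z = OnePoint.infty ∨ ∃ i ∈ A, za z = (i : OnePoint ι)) :
    LIndLE (Sph k) P (n : Ordinal.{0}) := by
  have := z_compact hφ
  have : CompactSpace P := isCompact_iff_compactSpace.mp hP.isCompact
  have := z_metrizable hφ hP A hPA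
  exact lIndLE_of_unst n (((unst_z hφ h).mono (subset_univ P)).subtype hP)

lemma z_lIndLE [Nonempty C] (hφ : ∀ i, φ i ∈ SFam C) {k n : ℕ} (hk : 1 ≤ k)
    (h : UnstOn (univ : Set C) (Fin (n + 1) × Fin k)) :
    LIndLE (Sph k) (ZSpace ι C C φ) ((n + 1 : ℕ) : Ordinal.{0}) := by
  have := z_compact hφ
  rw [lIndLE_iff]
  intro F hF f
  obtain ⟨ft, -, hft⟩ := extend_small hF.isClosedEmbedding_subtypeVal
    (⟨fun x i => (f x).1 i, continuous_pi fun i =>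
      (EuclideanSpace.proj (𝕜 := ℝ) i).continuous.comp (continuous_subtype_val.comp f.continuous)⟩ :
      C(F, Fin k → ℝ)) (t := Set.univ) ⟨0, trivial⟩ (fun _ _ => trivial)
  have hftn : ∀ x ∈ F, ft x ≠ 0 := by
    intro x hx h0
    have := hft ⟨x, hx⟩
    simp only [h0] at this
    exact sph_ne_zero (f ⟨x, hx⟩) this.symm
  obtain ⟨δ, hδ, hδ2⟩ := exists_pos_bound hF.isCompact ft hftn
  have hc : (fun _ => 1 : Fin k → ℝ) ≠ 0 := by
    intro h0
    have := congrFun h0 ⟨0, hk⟩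
    simp at this
  obtain ⟨A, U, g, hU, hg, hg0, hgf, hUA, -⟩ := z_construct hφ (δ⁻¹ • ft) (fun _ => 1) hc
  have hF1 : ∀ x ∈ F, 1 ≤ ‖(δ⁻¹ • ft) x‖ := by
    intro x hx
    obtain ⟨j, hj⟩ := hδ2 x hx
    have h1 : δ ≤ ‖ft x‖ := hj.trans (norm_le_pi_norm (ft x) j)
    rw [ContinuousMap.smul_apply, norm_smul, norm_inv, Real.norm_eq_abs, abs_of_pos hδ]
    rw [le_inv_mul_iff₀ hδ]
    linarith
  have hFU : F ⊆ U := fun x hx => (hgf x (hF1 x hx)).1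
  refine ⟨U, hU, hFU, ⟨⟨fun x => toSph (g x.1) (hg0 x.1 x.2),
    continuous_toSph (fun x : U => g x.1) (continuousOn_iff_continuous_restrict.mp hg) _⟩, ?_⟩, ?_⟩
  · intro x hx
    refine toSph_scale _ _ (hg0 x (hFU hx)) δ⁻¹ (inv_pos.mpr hδ) fun i => ?_
    have h1 : g x = δ⁻¹ • ft x := (hgf x (hF1 x hx)).2
    simp only [h1, Pi.smul_apply, smul_eq_mul]
    congr 1
    exact congrFun (hft ⟨x, hx⟩) i
  · right
    exact ⟨n, by exact_mod_cast Nat.lt_succ_self n, z_lIndLE_part hφ h hU.isClosed_compl A hUA⟩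

lemma z_kstr [Nonempty C] (hφ : ∀ i, φ i ∈ SFam C) {k n : ℕ} (hk : 2 ≤ k)
    (h : UnstOn (univ : Set C) (Fin (n + 1) × Fin k)) (F : Fin (k + 1) → Set (ZSpace ι C C φ))
    (hF : ∀ i, IsClosed (F i)) (hFK : IsKTuple (bComplex k) F) :
    ∃ U, KNbhd (bComplex k) F U ∧ KObs (bComplex k) U = ∅ ∧
      KIndLE (bComplex k) (↥(⋃ i, U i)ᶜ) (n : Ordinal.{0}) := by
  have := z_compact hφ
  obtain ⟨b, hb1, hb2⟩ := bary F hF hFK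
  let c : Fin (k + 1) → ℝ := fun i => if i = 0 then -(k : ℝ) else 1
  have hc0 : c ≠ 0 := by
    intro h0
    have := congrFun h0 ⟨1, by omega⟩
    simp [c] at this
  have hcs : ∑ i, c i = 0 := by
    rw [Fin.sum_univ_succ]
    simp [c, Fin.succ_ne_zero]
  have hcpos : ∀ l, l ≠ 0 → 0 ≤ c l := fun l hl => by simp [c, hl]
  obtain ⟨A, W, g, hW, hg, hg0, hgf, hWA, hlast⟩ := z_construct hφ b c hc0
  have hgs : ∀ w ∈ W, ∑ i, g w i = 0 := by
    intro w hw
    rcases hlast w hw with ⟨h1, -⟩ | h1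
    · rw [h1]; exact hb1 w
    · rw [h1]; exact hcs
  let U : Fin (k + 1) → Set (ZSpace ι C C φ) := fun i => W ∩ {w | g w i < 0}
  have hUo : ∀ i, IsOpen (U i) := by
    intro i
    have h1 : ContinuousOn (fun w => g w i) W := (continuous_apply i).comp_continuousOn hg
    exact h1.isOpen_inter_preimage hW isOpen_Iio
  have hUW : (⋃ i, U i) = W := by
    apply Subset.antisymm
    · exact iUnion_subset fun i => inter_subset_left
    · intro w hw
      obtain ⟨i, hi⟩ := exists_neg_of_sum_zero (hgs w hw) (hg0 w hw)
      exact mem_iUnion.mpr ⟨i, hw, hi⟩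
  have hUK : ∀ w, ∃ i, w ∉ U i := by
    intro w
    by_cases hw : w ∈ W
    · obtain ⟨i, hi⟩ := exists_nonneg_of_sum_zero (hgs w hw)
      exact ⟨i, fun hx => absurd (show g w i < 0 from hx.2) (not_lt.mpr hi)⟩
    · exact ⟨0, fun hx => hw hx.1⟩
  have hex : ∀ i : Fin (k + 1), ∃ l, l ≠ i ∧ l ≠ 0 := by
    intro i
    by_cases hi : i = ⟨1, by omega⟩
    · refine ⟨⟨2, by omega⟩, ?_, ?_⟩
      · rw [hi]; simp [Fin.ext_iff]
      · simp [Fin.ext_iff]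
    · exact ⟨⟨1, by omega⟩, fun h => hi h.symm, by simp [Fin.ext_iff]⟩
  refine ⟨U, ⟨hUo, isKTuple_iff.mpr hUK, ?_⟩, ?_, ?_⟩
  · intro i x hx
    have h1 : 1 ≤ ‖b x‖ := by
      refine le_trans ?_ (norm_le_pi_norm (b x) i)
      rw [hb2 i x hx]; simp
    obtain ⟨h2, h3⟩ := hgf x h1
    refine ⟨h2, ?_⟩
    show g x i < 0
    rw [h3, hb2 i x hx]
    norm_num
  · rw [eq_empty_iff_forall_notMem]
    intro z hz
    apply hz
    have claim : ∃ O : Set (ZSpace ι C C φ), IsOpen O ∧ z ∈ O ∧ ∃ i : Fin (k + 1),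
        ∀ w ∈ O, w ∈ W → ∃ l, l ≠ i ∧ w ∉ U l := by
      by_cases h0 : b z = 0
      · refine ⟨{w | ‖b w‖ < 1 / 4}, isOpen_lt b.continuous.norm continuous_const, ?_, 0, ?_⟩
        · show ‖b z‖ < 1 / 4
          rw [h0]; norm_num
        · intro w hw hwW
          obtain ⟨l, hl1, hl2⟩ := hex 0
          refine ⟨l, hl1, fun hx => ?_⟩
          rcases hlast w hwW with ⟨h1, h2⟩ | h1
          · exact absurd hw (not_lt.mpr h2)
          · have h3 : g w l < 0 := hx.2
            rw [h1] at h3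
            exact absurd h3 (not_lt.mpr (hcpos l hl2))
      · obtain ⟨j, hj⟩ : ∃ j, 0 < b z j := by
          obtain ⟨j, hj⟩ := exists_neg_of_sum_zero (h := fun i => -(b z i))
            (by rw [Finset.sum_neg_distrib, hb1, neg_zero]) (by
              intro h1
              apply h0
              funext i
              have := congrFun h1 i
              simp only [Pi.zero_apply] at this ⊢
              linarith)
          exact ⟨j, by linarith⟩
        obtain ⟨i, hi, -⟩ := hex j
        refine ⟨{w | 0 < b w j}, isOpen_lt continuous_const (by fun_prop), hj, i, ?_⟩
        intro w hw hwW
        rcases hlast w hwW with ⟨h1, h2⟩ | h1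
        · refine ⟨j, hi.symm, fun hx => ?_⟩
          have h3 : g w j < 0 := hx.2
          rw [h1] at h3
          exact lt_asymm h3 hw
        · obtain ⟨l, hl1, hl2⟩ := hex i
          refine ⟨l, hl1, fun hx => ?_⟩
          have h3 : g w l < 0 := hx.2
          rw [h1] at h3
          exact absurd h3 (not_lt.mpr (hcpos l hl2))
    obtain ⟨O, hO1, hO2, i, hO3⟩ := claim
    refine ⟨fun l => if l = i then U l ∪ O else U l, ⟨fun l => ?_, ?_, fun l => ?_⟩, ?_⟩
    · by_cases hl : l = i
      · simpa [hl] using (hUo i).union hO1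
      · simpa [hl] using hUo l
    · rw [isKTuple_iff]
      intro w
      by_cases hw : w ∈ O
      · by_cases hwW : w ∈ W
        · obtain ⟨l, hl1, hl2⟩ := hO3 w hw hwW
          exact ⟨l, by simpa [hl1] using hl2⟩
        · obtain ⟨l, hl1, -⟩ := hex i
          exact ⟨l, by simpa [hl1] using fun hx : w ∈ U l => hwW hx.1⟩
      · obtain ⟨l, hl⟩ := hUK w
        refine ⟨l, ?_⟩
        by_cases hli : l = i
        · subst hli
          simpa using ⟨hl, hw⟩
        · simpa [hli] using hl
    · by_cases hl : l = i
      · simp [hl]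
      · simp [hl]
    · exact mem_iUnion.mpr ⟨i, by simp [hO2]⟩
  · rw [hUW]
    have : NormalSpace ↥Wᶜ := hW.isClosed_compl.isClosedEmbedding_subtypeVal.normalSpace
    exact KIndLE.of_lIndLE (z_lIndLE_part hφ h hW.isClosed_compl A hWA)

end ZUpper

set_option linter.unusedSectionVars false

section ZLower

variable {ι C : Type} [TopologicalSpace ι] [DiscreteTopology ι] [MetricSpace C] [CompactSpace C]
  {φ : ι → Set C}

/-- Convergent sequences together with their limit belong to the family `𝒮`. -/
lemma seq_sfam {s : ℕ → C} {x : C} (hs : Filter.Tendsto s Filter.atTop (𝓝 x)) :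
    insert x (range s) ∈ SFam C := by
  by_cases hfin : (insert x (range s)).Finite
  · exact Or.inl hfin
  refine Or.inr ?_
  have hT : (insert x (range s) \ {x}).Infinite := by
    intro h
    exact hfin ((h.union (finite_singleton x)).subset (by
      intro y hy
      by_cases hyx : y = x
      · exact Or.inr hyx
      · exact Or.inl ⟨hy, hyx⟩))
  have hTc : (insert x (range s) \ {x}).Countable :=
    ((countable_range s).insert x).mono sdiff_subset
  have : Infinite ↥(insert x (range s) \ {x}) := hT.to_subtype
  have : Countable ↥(insert x (range s) \ {x}) := hTc.to_subtype
  obtain ⟨e⟩ : Nonempty (↥(insert x (range s) \ {x}) ≃ ℕ) := nonempty_equiv_of_countable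
  let f : OnePoint ℕ → ↥(insert x (range s)) := fun o =>
    Option.elim o ⟨x, mem_insert _ _⟩ (fun n => ⟨(e.symm n).1, (e.symm n).2.1⟩)
  have hf1 : f OnePoint.infty = ⟨x, mem_insert _ _⟩ := rfl
  have hf2 : ∀ n : ℕ, f (n : OnePoint ℕ) = ⟨(e.symm n).1, (e.symm n).2.1⟩ := fun n => rfl
  have hcont : Continuous f := by
    rw [OnePoint.continuous_iff_from_nat, hf1, tendsto_subtype_rng]
    simp only [hf2]
    intro V hV
    rw [Filter.mem_map, ← Nat.cofinite_eq_atTop, Filter.mem_cofinite]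
    have h1 : {m | s m ∉ V}.Finite := by
      have := hs hV
      rw [Filter.mem_map, ← Nat.cofinite_eq_atTop, Filter.mem_cofinite] at this
      exact this
    have h2 : (s '' {m | s m ∉ V}).Finite := h1.image s
    refine (h2.preimage (f := fun n => (e.symm n).1)
      (Subtype.val_injective.comp e.symm.injective).injOn).subset ?_
    intro n hn
    rcases (e.symm n).2.1 with h3 | ⟨m, hm⟩
    · exact absurd h3 (e.symm n).2.2
    · refine ⟨m, ?_, hm⟩
      intro h4
      apply hn
      change (e.symm n).1 ∈ V
      rw [← hm]
      exact h4
  have hbij : Function.Bijective f := by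
    constructor
    · intro a b hab
      induction a using OnePoint.rec with
      | infty =>
        induction b using OnePoint.rec with
        | infty => rfl
        | coe b =>
          rw [hf1, hf2, Subtype.mk.injEq] at hab
          exact absurd hab.symm (e.symm b).2.2
      | coe a =>
        induction b using OnePoint.rec with
        | infty =>
          rw [hf1, hf2, Subtype.mk.injEq] at hab
          exact absurd hab (e.symm a).2.2
        | coe b =>
          rw [hf2, hf2, Subtype.mk.injEq] at hab
          rw [e.symm.injective (Subtype.val_injective hab)]
    · rintro ⟨y, hy⟩
      by_cases hyx : y = x
      · exact ⟨OnePoint.infty, by rw [hf1]; simp [hyx]⟩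
      · exact ⟨(e ⟨y, hy, hyx⟩ : ℕ), by rw [hf2]; simp⟩
  exact ⟨(Continuous.homeoOfEquivCompactToT2 (f := Equiv.ofBijective f hbij) hcont).symm⟩

/-- The index set is uncountable as soon as `C` is a non-degenerate continuum. -/
lemma card_gt [ConnectedSpace C] (hC : ¬ CovDimLE C 0) (hι : ZCardOK C C ι) : ℵ₀ < #ι := by
  by_contra hcon
  have h1 : tWeight C < ℵ₀ := lt_of_lt_of_le hι.2.1 (not_lt.mp hcon)
  have hmem : tWeight C ∈ {c | ∃ B : Set (Set C), TopologicalSpace.IsTopologicalBasis B ∧ #B = c} :=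
    csInf_mem ⟨_, _, TopologicalSpace.isTopologicalBasis_opens, rfl⟩
  obtain ⟨B, hB, hBc⟩ := hmem
  rw [← hBc, Cardinal.lt_aleph0_iff_set_finite] at h1
  have hfin : Finite C := by
    have := h1.to_subtype
    refine Finite.of_injective (fun x : C => ({b : ↥B | x ∈ b.1} : Set ↥B)) ?_
    intro x y hxy
    by_contra hne
    obtain ⟨b, hb, hxb, hby⟩ := hB.exists_subset_of_mem_open
      (show x ∈ ({y} : Set C)ᶜ from hne) isOpen_compl_singleton
    have h2 : (⟨b, hb⟩ : ↥B) ∈ {b : ↥B | x ∈ b.1} := hxb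
    have h3 : ({b : ↥B | x ∈ b.1} : Set ↥B) = {b : ↥B | y ∈ b.1} := hxy
    rw [h3] at h2
    exact hby h2 rfl
  have hsub : Subsingleton C := by
    have : PreconnectedSpace C := inferInstance
    exact PreconnectedSpace.trivial_of_discrete
  apply hC
  intro T hT U hU hc
  obtain ⟨x⟩ : Nonempty C := inferInstance
  obtain ⟨i, hi⟩ : ∃ i, x ∈ U i := by simpa using (hc ▸ mem_univ x : x ∈ ⋃ i, U i)
  refine ⟨fun j => if j = i then U j else ∅, fun j => ?_, fun j => ?_, ?_, fun y => ?_⟩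
  · by_cases h : j = i <;> simp [h, hU]
  · by_cases h : j = i <;> simp [h]
  · ext y
    simp only [mem_iUnion, mem_univ, iff_true]
    exact ⟨i, by rw [Subsingleton.elim y x]; simpa using hi⟩
  · have : {j | y ∈ if j = i then U j else ∅} ⊆ {i} := by
      intro j hj
      by_contra h
      have h' : j ≠ i := h
      simp [h'] at hj
    exact (ncard_le_ncard this).trans (by simp)

end ZLower

set_option linter.unusedSectionVars false

section ZLowerMain

variable {ι C : Type} [TopologicalSpace ι] [DiscreteTopology ι] [MetricSpace C] [CompactSpace C]
  {φ : ι → Set C}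

/-- If `x` is an obstruction point over `H(μ)`, a whole copy of `C` lies in the partition. -/
lemma obstruction_copy {k : ℕ} (hφ : ZPhiOK φ) (hι : ℵ₀ < #ι)
    (U : Fin (k + 1) → Set (ZSpace ι C C φ)) (hUo : ∀ i, IsOpen (U i))
    (hUK : IsKTuple (bComplex k) U) (x : C)
    (hx : ∀ O : Set C, IsOpen O → x ∈ O → ∀ i, ∃ y ∈ O, ∀ j, j ≠ i → hmu φ y ∈ U j) :
    ∃ i, ∃ p : φ i, ∀ y, hal φ i (p, y) ∈ (⋃ l, U l)ᶜ := by
  rw [isKTuple_iff] at hUK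
  have h1 : ∀ m : ℕ, ∃ y, dist y x < 1 / ((m : ℝ) + 1) ∧
      ∀ j, j ≠ Fin.ofNat (k + 1) m → hmu φ y ∈ U j := by
    intro m
    obtain ⟨y, hy, hy2⟩ := hx (Metric.ball x (1 / ((m : ℝ) + 1))) Metric.isOpen_ball
      (Metric.mem_ball_self (by positivity)) (Fin.ofNat (k + 1) m)
    exact ⟨y, hy, hy2⟩
  choose s hs1 hs2 using h1
  have hs : Filter.Tendsto s Filter.atTop (𝓝 x) := by
    rw [tendsto_iff_dist_tendsto_zero]
    exact squeeze_zero (fun m => dist_nonneg) (fun m => (hs1 m).le)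
      tendsto_one_div_add_atTop_nhds_zero_nat
  have hS := seq_sfam hs
  have h2 : ∀ m : ℕ, ∃ A : Finset ι, ∀ z : ZSpace ι C C φ,
      (∀ i ∈ A, za z ≠ (i : OnePoint ι)) → ZProjX φ z = s m →
        ∀ j, j ≠ Fin.ofNat (k + 1) m → z ∈ U j := by
    intro m
    have hO : IsOpen (⋂ j : Fin (k + 1), {z | j ≠ Fin.ofNat (k + 1) m → z ∈ U j}) := by
      refine isOpen_iInter_of_finite fun j => ?_
      by_cases hj : j = Fin.ofNat (k + 1) m
      · simp [hj]
      · have h0 : {z | j ≠ Fin.ofNat (k + 1) m → z ∈ U j} = U j := by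
          ext z
          exact ⟨fun h => h hj, fun h _ => h⟩
        rw [h0]
        exact hUo j
    obtain ⟨A, V, hV, hA⟩ := z_tube hφ.1 hO (x := s m) (mem_iInter.mpr fun j hj => hs2 m j hj)
    refine ⟨A, fun z hz hzr => ?_⟩
    have := hA z hz (by rw [hzr]; exact mem_of_mem_nhds hV)
    exact fun j hj => mem_iInter.mp this j hj
  choose A hA using h2
  obtain ⟨a, ha1, ha2⟩ : ∃ a, φ a = insert x (range s) ∧ ∀ m, a ∉ A m := by
    by_contra hcon
    push Not at hcon
    have hsub : φ ⁻¹' {insert x (range s)} ⊆ ⋃ m, (A m : Set ι) := by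
      intro a ha
      obtain ⟨m, hm⟩ := hcon a ha
      exact mem_iUnion.mpr ⟨m, hm⟩
    have hcount : (φ ⁻¹' {insert x (range s)}).Countable :=
      (countable_iUnion fun m => (A m).countable_toSet).mono hsub
    have h3 := hφ.2 _ hS
    have h4 : #(↥(φ ⁻¹' {insert x (range s)})) ≤ ℵ₀ := hcount.le_aleph0
    rw [h3] at h4
    exact absurd hι (not_lt.mpr h4)
  have hxa : x ∈ φ a := by rw [ha1]; exact mem_insert _ _
  have hsa : ∀ m, s m ∈ φ a := fun m => by rw [ha1]; exact mem_insert_of_mem _ (mem_range_self m)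
  refine ⟨a, ⟨x, hxa⟩, fun y hy => ?_⟩
  obtain ⟨i, hi⟩ := mem_iUnion.mp hy
  have hlim : Filter.Tendsto (fun m => hal φ a (⟨s m, hsa m⟩, y)) Filter.atTop
      (𝓝 (hal φ a (⟨x, hxa⟩, y))) := by
    refine ((continuous_hal a).tendsto _).comp ?_
    refine Filter.Tendsto.prodMk_nhds ?_ tendsto_const_nhds
    rw [tendsto_subtype_rng]
    exact hs
  have hev := hlim ((hUo i).mem_nhds hi)
  rw [Filter.mem_map, Filter.mem_atTop_sets] at hev
  obtain ⟨N, hN⟩ := hev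
  set M : ℕ := (k + 1) * N + i.1 with hM
  have hMi : Fin.ofNat (k + 1) M = i := by
    apply Fin.ext
    simp [hM, Nat.mod_eq_of_lt i.2]
  have hMN : N ≤ M := by rw [hM]; nlinarith
  obtain ⟨j, hj⟩ := hUK (hal φ a (⟨s M, hsa M⟩, y))
  apply hj
  by_cases hji : j = i
  · rw [hji]; exact hN M hMN
  · refine hA M _ (fun b hb hab => ?_) (by rw [zr_hal]) j (by rw [hMi]; exact hji)
    rw [za_hal] at hab
    exact ha2 M (by rw [OnePoint.coe_injective hab]; exact hb)

/-- The lower bound for the inductive dimension. -/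
lemma z_not_kIndLE {k n : ℕ} (hk : 1 ≤ k) (hn : 1 ≤ n) (hφ : ZPhiOK φ) (hι : ℵ₀ < #ι)
    (hmin : ∀ m, CovDimLE C m → k * (n + 1) - 1 ≤ m) :
    ¬ KIndLE (bComplex k) (ZSpace ι C C φ) (n : Ordinal.{0}) := by
  intro hZ
  obtain ⟨n, rfl⟩ : ∃ n', n = n' + 1 := ⟨n - 1, by omega⟩
  obtain ⟨e, he⟩ : ∃ e, (n + 1) * k = e + 1 :=
    ⟨(n + 1) * k - 1, by have : 1 ≤ (n + 1) * k := Nat.mul_pos (by omega) hk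
                         omega⟩
  have hke : k * (n + 1 + 1) = k + (e + 1) := by rw [← he]; ring
  have hcov : ∀ m, UnstOn (univ : Set C) (Fin (m + 1)) → k + e ≤ m := by
    intro m hm
    have := hmin m (covDimLE_of_unst hm)
    omega
  have key : ∀ F : Fin (k + 1) → Set C, (∀ i, IsClosed (F i)) → IsKTuple (bComplex k) F →
      ∃ U, KNbhd (bComplex k) F U ∧ UnstOn (⋃ i, U i)ᶜ (Fin e) := by
    intro F hF hFK
    obtain ⟨U, ⟨hUo, hUK, hFU⟩, hP⟩ := kIndLE_iff.mp hZ (fun i => ZProjX φ ⁻¹' F i)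
      (fun i => (hF i).preimage continuous_zr) (by
        rw [isKTuple_iff] at hFK ⊢
        exact fun z => hFK _)
    have hPc : IsClosed (⋃ i, U i)ᶜ := (isOpen_iUnion hUo).isClosed_compl
    have hP' : KIndLE (bComplex k) (↥(⋃ i, U i)ᶜ) (n : Ordinal.{0}) := by
      rcases hP with hP | ⟨β, hβ, hP⟩
      · rw [kIndLE_iff]
        intro F' hF' hK'
        refine ⟨fun _ => ∅, ⟨fun _ => isOpen_empty, ?_, fun i z => ?_⟩, Or.inl ?_⟩
        · rw [isKTuple_iff]
          exact fun z => ⟨0, by simp⟩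
        · exact absurd (hP ▸ z.2 : z.1 ∈ (∅ : Set (ZSpace ι C C φ))) (by simp)
        · ext z
          exact absurd (hP ▸ z.2 : z.1 ∈ (∅ : Set (ZSpace ι C C φ))) (by simp)
      · refine hP.mono ?_
        have : β < Order.succ (n : Ordinal.{0}) := by
          have : ((n + 1 : ℕ) : Ordinal.{0}) = Order.succ (n : Ordinal.{0}) := by
            push_cast; rfl
          rwa [this] at hβ
        exact Order.lt_succ_iff.mp this
    -- the trace on `H(μ)`
    have hQc : IsClosed (hmu φ ⁻¹' (⋃ i, U i)ᶜ) := hPc.preimage continuous_hmu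
    have hQ : UnstOn (hmu φ ⁻¹' (⋃ i, U i)ᶜ) (Fin (e + 1)) := by
      have hemb : IsClosedEmbedding
          (fun x : ↥(hmu φ ⁻¹' (⋃ i, U i)ᶜ) => (⟨hmu φ x.1, x.2⟩ : ↥(⋃ i, U i)ᶜ)) := by
        have : CompactSpace ↥(hmu φ ⁻¹' (⋃ i, U i)ᶜ) := isCompact_iff_compactSpace.mp hQc.isCompact
        refine Continuous.isClosedEmbedding ?_ ?_
        · exact Continuous.subtype_mk (continuous_hmu.comp continuous_subtype_val) _
        · intro a b hab
          exact Subtype.ext (hmu_injective (congrArg Subtype.val hab))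
      have := unst_of_kIndLE n (hP'.closedEmbedding hemb)
      refine (UnstOn.of_subtype hQc this).of_card_le ?_
      simp [he]
    -- no obstruction
    have hnob : ∀ x, ∃ O : Set C, IsOpen O ∧ x ∈ O ∧ ∃ i, ∀ y ∈ O, ∃ j, j ≠ i ∧ hmu φ y ∉ U j := by
      intro x
      by_contra hcon
      push Not at hcon
      obtain ⟨i, p, hp⟩ := obstruction_copy hφ hι U hUo hUK x hcon
      have hemb : IsClosedEmbedding
          (fun y : C => (⟨hal φ i (p, y), hp y⟩ : ↥(⋃ i, U i)ᶜ)) := by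
        refine Continuous.isClosedEmbedding ?_ ?_
        · exact Continuous.subtype_mk ((continuous_hal i).comp (by fun_prop)) _
        · intro a b hab
          exact congrArg Prod.snd (hal_injective i (congrArg Subtype.val hab))
      have := unst_of_kIndLE n (hP'.closedEmbedding hemb)
      have h2 := hcov e (this.of_card_le (by simp [he]))
      omega
    choose O hO1 hO2 c hO3 using hnob
    obtain ⟨O', hO'1, hO'2, hO'3, hO'4⟩ := disjointify hQc hQ
      (fun i => ⋃ x : {x // c x = i}, O x.1) (fun i => isOpen_iUnion fun x => hO1 x.1)
      (fun x _ => mem_iUnion.mpr ⟨c x, mem_iUnion.mpr ⟨⟨x, rfl⟩, hO2 x⟩⟩)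
    refine ⟨fun i => hmu φ ⁻¹' U i ∪ O' i, ⟨fun i => ((hUo i).preimage continuous_hmu).union (hO'1 i),
      ?_, fun i x hx => Or.inl (hFU i hx)⟩, hO'4.mono ?_⟩
    · rw [isKTuple_iff] at hUK ⊢
      intro y
      by_cases hy : ∃ i, y ∈ O' i
      · obtain ⟨i, hi⟩ := hy
        obtain ⟨⟨x, hx⟩, hyx⟩ := mem_iUnion.mp (hO'2 i hi)
        obtain ⟨j, hj1, hj2⟩ := hO3 x y hyx
        refine ⟨j, ?_⟩
        rintro (h | h)
        · exact hj2 h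
        · exact hj1 ((hO'3 y j i h hi).trans hx.symm)
      · obtain ⟨i, hi⟩ := hUK (hmu φ y)
        refine ⟨i, ?_⟩
        rintro (h | h)
        · exact hi h
        · exact hy ⟨i, h⟩
    · intro y hy
      simp only [mem_compl_iff, mem_iUnion, mem_union, not_exists, not_or] at hy
      refine ⟨?_, ?_⟩
      · simp only [mem_preimage, mem_compl_iff, mem_iUnion, not_exists]
        exact fun i => (hy i).1
      · simp only [mem_iUnion, not_exists]
        exact fun i => (hy i).2
  have h3 := combine key
  have h4 := hcov (k + e - 1) (h3.of_card_le (by simp; omega))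
  omega

end ZLowerMain

-- STATEMENT 18
theorem statement18 (k n : ℕ) (hk : 1 ≤ k) (hn : 1 ≤ n)
    (C : Type) [MetricSpace C] [CompactSpace C] [ConnectedSpace C]
    (hdim : covDim C = Dim.ofOrdinal ((k * (n + 1) - 1 : ℕ) : Ordinal.{0}))
    (ι : Type) [TopologicalSpace ι] [DiscreteTopology ι]
    (hι : ZCardOK C C ι) (φ : ι → Set C) (hφ : ZPhiOK φ) :
    CompactSpace (ZSpace ι C C φ) ∧ FrechetUrysohnSpace (ZSpace ι C C φ) ∧
    KDim (bComplex k) (ZSpace ι C C φ) = Dim.ofOrdinal ((n : ℕ) : Ordinal.{0}) ∧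
    KInd (bComplex k) (ZSpace ι C C φ) = Dim.ofOrdinal ((n + 1 : ℕ) : Ordinal.{0}) ∧
    LInd (↥(Metric.sphere (0 : EuclideanSpace ℝ (Fin k)) 1)) (ZSpace ι C C φ) =
      Dim.ofOrdinal ((n + 1 : ℕ) : Ordinal.{0}) ∧
    (2 ≤ k → KStr (bComplex k) (ZSpace ι C C φ) = 0) ∧
    ∀ z : ZSpace ι C C φ, Nonempty (↥(connectedComponent z) ≃ₜ C) := by
  have hne : Nonempty C := inferInstance
  have hkn : 2 ≤ k * (n + 1) := by nlinarith
  have hC0 : ¬ IsEmpty C := not_isEmpty_iff.mpr hne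
  have hex : ∃ m, CovDimLE C m := by
    by_contra hcon
    simp only [covDim, hC0, if_false, hcon] at hdim
    exact absurd hdim (by simp [Dim.ofOrdinal])
  have hs : sInf {m | CovDimLE C m} = k * (n + 1) - 1 := by
    simp only [covDim, hC0, if_false, hex, if_true] at hdim
    have h1 := WithBot.coe_injective (WithTop.coe_injective hdim)
    exact_mod_cast h1
  have hle : CovDimLE C (k * (n + 1) - 1) := by
    rw [← hs]
    exact Nat.sInf_mem hex
  have hmin : ∀ m, CovDimLE C m → k * (n + 1) - 1 ≤ m := by
    intro m hm
    rw [← hs]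
    exact Nat.sInf_le hm
  have hun : UnstOn (univ : Set C) (Fin (n + 1) × Fin k) := by
    refine (unst_of_covDimLE hle).of_card_le ?_
    have : (n + 1) * k = k * (n + 1) := by ring
    simp only [Fintype.card_fin, Fintype.card_prod]
    omega
  have hιc : ℵ₀ < #ι := card_gt (fun h => by have := hmin 0 h; omega) hι
  have hcomp := z_compact hφ.1
  obtain ⟨c0⟩ := hne
  have hZ0 : ¬ IsEmpty (ZSpace ι C C φ) := not_isEmpty_iff.mpr ⟨hmu φ c0⟩
  have hne : Nonempty C := ⟨c0⟩
  have hL := z_lIndLE hφ.1 hk hun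
  have hK : KIndLE (bComplex k) (ZSpace ι C C φ) ((n + 1 : ℕ) : Ordinal.{0}) :=
    KIndLE.of_lIndLE hL
  have hKnot := z_not_kIndLE hk hn hφ hιc hmin
  have hKlow : ∀ α : Ordinal.{0}, KIndLE (bComplex k) (ZSpace ι C C φ) α →
      ((n + 1 : ℕ) : Ordinal.{0}) ≤ α := by
    intro α hα
    by_contra hcon
    have h1 : α < Order.succ (n : Ordinal.{0}) := by
      have : ((n + 1 : ℕ) : Ordinal.{0}) = Order.succ (n : Ordinal.{0}) := by
        push_cast; rfl
      rw [← this]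
      exact not_le.mp hcon
    exact hKnot (hα.mono (Order.lt_succ_iff.mp h1))
  have hKInd : KInd (bComplex k) (ZSpace ι C C φ) = Dim.ofOrdinal ((n + 1 : ℕ) : Ordinal.{0}) := by
    have h1 : ∃ α, KIndLE (bComplex k) (ZSpace ι C C φ) α := ⟨_, hK⟩
    simp only [KInd, hZ0, if_false, h1, if_true]
    congr 1
    exact le_antisymm (csInf_le' hK) (le_csInf h1 hKlow)
  refine ⟨hcomp, z_frechet hφ.1, ?_, hKInd, ?_, ?_, z_component hφ.1⟩
  · have hD : KDimLE (bComplex k) (ZSpace ι C C φ) n := kDimLE_of_unst (unst_z hφ.1 hun)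
    have h1 : ∃ m, KDimLE (bComplex k) (ZSpace ι C C φ) m := ⟨_, hD⟩
    simp only [KDim, hZ0, if_false, h1, if_true]
    congr 2
    refine le_antisymm (Nat.sInf_le hD) (le_csInf h1 ?_)
    intro m hm
    have h2 := unst_of_kDimLE (kDimLE_closedEmbedding (hmu_closedEmbedding (φ := φ)) hm)
    have hmk : 1 ≤ (m + 1) * k := Nat.mul_pos (by omega) hk
    have h3 : UnstOn (univ : Set C) (Fin ((m + 1) * k - 1 + 1)) :=
      h2.of_card_le (by simp only [Fintype.card_fin, Fintype.card_prod]; omega)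
    have h4 := hmin _ (covDimLE_of_unst h3)
    have h5 : k * (n + 1) ≤ k * (m + 1) := by
      have : (m + 1) * k = k * (m + 1) := by ring
      omega
    have := Nat.le_of_mul_le_mul_left h5 hk
    omega
  · have h1 : ∃ α, LIndLE (Sph k) (ZSpace ι C C φ) α := ⟨_, hL⟩
    simp only [LInd, hZ0, if_false, h1, if_true]
    congr 1
    exact le_antisymm (csInf_le' hL) (le_csInf h1 fun α hα => hKlow α (KIndLE.of_lIndLE hα))
  · intro hk2
    have hns : ¬ KStrongly (bComplex k) (ZSpace ι C C φ) := by
      rintro ⟨-, F, hF, hFK, hU⟩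
      obtain ⟨U, hU1, hU2, hU3⟩ := z_kstr hφ.1 hk2 hun F hF hFK
      refine hU U hU1 ?_ hU2
      rw [hKInd]
      by_cases he : IsEmpty ↥(⋃ i, U i)ᶜ
      · simp only [KInd, he, if_true]
        exact WithTop.coe_lt_coe.mpr (WithBot.bot_lt_coe _)
      · have h1 : ∃ α, KIndLE (bComplex k) (↥(⋃ i, U i)ᶜ) α := ⟨_, hU3⟩
        simp only [KInd, he, if_false, h1, if_true]
        refine WithTop.coe_lt_coe.mpr (WithBot.coe_lt_coe.mpr ?_)
        exact lt_of_le_of_lt (csInf_le' hU3) (by exact_mod_cast Nat.lt_succ_self n)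
    simp [KStr, hns]

end
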